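/- arXiv:1801.05320 — 4 statements merged into one kernel-verified Lean document; each statement's English description precedes it below -/
import Mathlib

section
/- Let n ≥ 3 and suppose that for every subset J ⊆ {1,…,n−1} the standard parabolic subgroup P_J(R) ≤ SL_n(R) is finitely generated. Fix k ∈ {1,…,n−1} and set I = {1,…,n−1} \ {k}, so that P_I(R) is a standard maximal parabolic subgroup. Then P_I(R) is finitely presented if and only if its Levi factor L_I(R) is finitely presented. (This is the paper's corollary on maximal parabolics in simply-laced root systems, in type A_{n−1}.) -/
/-- A group is finitely presented if it is isomorphic to the quotient of a
finitely generated free group by the normal closure of a finite set. -/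
def IsFinitelyPresented (G : Type*) [Group G] : Prop :=
  ∃ (m : ℕ) (S : Finset (FreeGroup (Fin m))),
    Nonempty ((FreeGroup (Fin m) ⧸ Subgroup.normalClosure (S : Set (FreeGroup (Fin m)))) ≃* G)

/-- The elementary matrix `1 + r·E i j` as an element of `SL_n(R)`. -/
def elemMat {n : ℕ} {R : Type*} [CommRing R] (i j : Fin n) (hij : i ≠ j) (r : R) :
    Matrix.SpecialLinearGroup (Fin n) R :=
  ⟨Matrix.transvection i j r, Matrix.det_transvection_of_ne i j hij r⟩

/-- The set of diagonal matrices in `SL_n(R)`. -/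
def diagMats (n : ℕ) (R : Type*) [CommRing R] :
    Set (Matrix.SpecialLinearGroup (Fin n) R) :=
  {g | (g : Matrix (Fin n) (Fin n) R).IsDiag}

/-- For (0-based) indices `i < j` in `Fin n`, the (1-based) pair `(i+1, j+1)` is
`I`-connected if every simple-root index `k` with `i+1 ≤ k ≤ j` lies in `I`. -/
def IConn {n : ℕ} (I : Set ℕ) (i j : Fin n) : Prop :=
  ∀ k : ℕ, i.val + 1 ≤ k → k ≤ j.val → k ∈ I

/-- Upper elementary matrices `e_{ij}(r)` with `i < j` a `J`-connected pair. -/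
def upperElems (n : ℕ) (R : Type*) [CommRing R] (J : Set ℕ) :
    Set (Matrix.SpecialLinearGroup (Fin n) R) :=
  {g | ∃ (i j : Fin n) (h : i < j) (r : R), IConn J i j ∧ g = elemMat i j (ne_of_lt h) r}

/-- All upper elementary matrices `e_{ij}(r)`, `i < j`. -/
def allUpperElems (n : ℕ) (R : Type*) [CommRing R] :
    Set (Matrix.SpecialLinearGroup (Fin n) R) :=
  {g | ∃ (i j : Fin n) (h : i < j) (r : R), g = elemMat i j (ne_of_lt h) r}

/-- Lower elementary matrices `e_{ji}(r)` with `i < j` an `I`-connected pair. -/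
def lowerElems (n : ℕ) (R : Type*) [CommRing R] (I : Set ℕ) :
    Set (Matrix.SpecialLinearGroup (Fin n) R) :=
  {g | ∃ (i j : Fin n) (h : i < j) (r : R), IConn I i j ∧ g = elemMat j i (ne_of_gt h) r}

/-- The standard parabolic subgroup `P_I(R) ≤ SL_n(R)`. -/
def parabolic (n : ℕ) (R : Type*) [CommRing R] (I : Set ℕ) :
    Subgroup (Matrix.SpecialLinearGroup (Fin n) R) :=
  Subgroup.closure (diagMats n R ∪ allUpperElems n R ∪ lowerElems n R I)

/-- The Levi factor `L_I(R) ≤ SL_n(R)`. -/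
def levi (n : ℕ) (R : Type*) [CommRing R] (I : Set ℕ) :
    Subgroup (Matrix.SpecialLinearGroup (Fin n) R) :=
  Subgroup.closure (diagMats n R ∪ upperElems n R I ∪ lowerElems n R I)

/-- `Adj(I)`: simple-root indices not in `I` adjacent to an element of `I`. -/
def adjSet (n : ℕ) (I : Set ℕ) : Set ℕ :=
  {k | k ∈ Set.Icc 1 (n - 1) ∧ k ∉ I ∧ (k - 1 ∈ I ∨ k + 1 ∈ I)}

/-- `nonAdj(I)`: simple-root indices neither in `I` nor adjacent to `I`. -/
def nonAdjSet (n : ℕ) (I : Set ℕ) : Set ℕ :=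
  Set.Icc 1 (n - 1) \ (I ∪ adjSet n I)

/-- The extended Levi factor `LE_I(R)` (for `I ≠ ∅`): generated by the Levi factor
together with all `e_{ij}(r)`, `i < j` a `nonAdj(I)`-connected pair. -/
def extLevi (n : ℕ) (R : Type*) [CommRing R] (I : Set ℕ) :
    Subgroup (Matrix.SpecialLinearGroup (Fin n) R) :=
  Subgroup.closure (diagMats n R ∪ upperElems n R I ∪ lowerElems n R I ∪
    upperElems n R (nonAdjSet n I))

open scoped commutatorElement

theorem specialLinearGroup_ext {n : ℕ} {R : Type*} [CommRing R]
    {g h : Matrix.SpecialLinearGroup (Fin n) R}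
    (H : (g : Matrix (Fin n) (Fin n) R) = h) : g = h :=
  Subtype.ext H

theorem coe_elemMat {n : ℕ} {R : Type*} [CommRing R] (i j : Fin n) (h : i ≠ j) (r : R) :
    (elemMat i j h r : Matrix (Fin n) (Fin n) R) = 1 + Matrix.single i j r := rfl

theorem elemMat_add {n : ℕ} {R : Type*} [CommRing R] (i j : Fin n) (h : i ≠ j) (r s : R) :
    elemMat i j h (r + s) = elemMat i j h r * elemMat i j h s :=
  Subtype.ext (Matrix.transvection_mul_transvection_same i j h r s).symm

theorem elemMat_zero {n : ℕ} {R : Type*} [CommRing R] (i j : Fin n) (h : i ≠ j) :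
    elemMat i j h (0 : R) = 1 :=
  Subtype.ext (Matrix.transvection_zero i j)

theorem elemMat_inv {n : ℕ} {R : Type*} [CommRing R] (i j : Fin n) (h : i ≠ j) (r : R) :
    (elemMat i j h r)⁻¹ = elemMat i j h (-r) :=
  inv_eq_of_mul_eq_one_right (by rw [← elemMat_add, add_neg_cancel, elemMat_zero])

theorem elemMat_commutator {n : ℕ} {R : Type*} [CommRing R] {i j k : Fin n} (hij : i ≠ j)
    (hjk : j ≠ k) (hik : i ≠ k) (r s : R) :
    ⁅elemMat i j hij r, elemMat j k hjk s⁆ = elemMat i k hik (r * s) := by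
  rw [commutatorElement_def, mul_inv_eq_iff_eq_mul, mul_inv_eq_iff_eq_mul]
  refine specialLinearGroup_ext ?_
  simp only [coe_elemMat, Matrix.SpecialLinearGroup.coe_mul, mul_add, add_mul,
    mul_one, one_mul, Matrix.single_mul_single_same, Matrix.single_mul_single_of_ne _ _ _ _
    hik.symm,
    Matrix.single_mul_single_of_ne _ _ _ _ hjk.symm, zero_mul]
  abel

theorem elemMat_commute {n : ℕ} {R : Type*} [CommRing R] {i j k l : Fin n} (hij : i ≠ j)
    (hkl : k ≠ l) (hjk : j ≠ k) (hil : i ≠ l) (r s : R) :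
    Commute (elemMat i j hij r) (elemMat k l hkl s) := by
  refine specialLinearGroup_ext ?_
  simp only [coe_elemMat, Matrix.SpecialLinearGroup.coe_mul, mul_add, add_mul,
    mul_one, one_mul, Matrix.single_mul_single_of_ne _ _ _ _ hjk,
    Matrix.single_mul_single_of_ne _ _ _ _ hil.symm]
  abel

/-- The invertible diagonal matrices of determinant one, as tuples of units. -/
def torus (n : ℕ) (R : Type*) [CommRing R] : Subgroup (Fin n → Rˣ) where
  carrier := {t | ∏ i, t i = 1}
  one_mem' := by simp
  mul_mem' {s t} hs ht := by
    simp only [Set.mem_ofPred_eq] at hs ht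
    simp [Finset.prod_mul_distrib, hs, ht]
  inv_mem' {s} hs := by
    simp only [Set.mem_ofPred_eq] at hs
    simp [hs]

/-- The embedding of the torus in `SL_n(R)` by diagonal matrices. -/
def torusHom (n : ℕ) (R : Type*) [CommRing R] :
    torus n R →* Matrix.SpecialLinearGroup (Fin n) R where
  toFun t := ⟨Matrix.diagonal fun i => (t.1 i : R), by
    rw [Matrix.det_diagonal, ← Units.coe_prod, show ∏ i, t.1 i = 1 from t.2, Units.val_one]⟩
  map_one' := specialLinearGroup_ext (by simp)
  map_mul' s t := specialLinearGroup_ext <| by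
    change _ = Matrix.diagonal _ * Matrix.diagonal _
    simp

theorem coe_torusHom {n : ℕ} {R : Type*} [CommRing R] (t : torus n R) :
    (torusHom n R t : Matrix (Fin n) (Fin n) R) = Matrix.diagonal fun i => (t.1 i : R) := rfl

theorem range_torusHom (n : ℕ) (R : Type*) [CommRing R] :
    ((torusHom n R).range : Set (Matrix.SpecialLinearGroup (Fin n) R)) = diagMats n R := by
  ext g
  constructor
  · rintro ⟨t, rfl⟩
    exact Matrix.isDiag_diagonal _
  · intro hg
    have hd : Matrix.diagonal (Matrix.diag (g : Matrix (Fin n) (Fin n) R)) = g :=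
      Matrix.IsDiag.diagonal_diag hg
    have hp : ∏ i, (g : Matrix (Fin n) (Fin n) R) i i = 1 := by
      have := g.2
      rw [← hd, Matrix.det_diagonal] at this
      exact this
    have hu (i : Fin n) : IsUnit ((g : Matrix (Fin n) (Fin n) R) i i) :=
      isUnit_of_dvd_one ((Finset.dvd_prod_of_mem (fun i => (g : Matrix (Fin n) (Fin n) R) i i)
        (Finset.mem_univ i)).trans (dvd_of_eq hp))
    refine ⟨⟨fun i => (hu i).unit, Units.ext (by simpa using hp)⟩, specialLinearGroup_ext ?_⟩
    rw [coe_torusHom]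
    exact hd

/-- The character of the torus on the root `(i, j)`. -/
def torusWeight {n : ℕ} {R : Type*} [CommRing R] (i j : Fin n) : torus n R →* Rˣ where
  toFun t := t.1 i * (t.1 j)⁻¹
  map_one' := by simp
  map_mul' s t := by simp [mul_mul_mul_comm, mul_comm]

theorem torusWeight_mul_torusWeight {n : ℕ} {R : Type*} [CommRing R] (i j k : Fin n)
    (t : torus n R) : torusWeight i j t * torusWeight j k t = torusWeight i k t := by
  simp [torusWeight]

theorem torusHom_semiconj_elemMat {n : ℕ} {R : Type*} [CommRing R] {i j : Fin n} (h : i ≠ j)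
    (t : torus n R) (r : R) :
    SemiconjBy (torusHom n R t) (elemMat i j h r) (elemMat i j h (torusWeight i j t * r)) := by
  refine specialLinearGroup_ext ?_
  simp only [coe_elemMat, Matrix.SpecialLinearGroup.coe_mul, coe_torusHom,
    mul_add, add_mul, mul_one, one_mul]
  congr 1
  ext a b
  rw [Matrix.diagonal_mul, Matrix.mul_diagonal]
  by_cases hab : i = a ∧ j = b
  · obtain ⟨rfl, rfl⟩ := hab
    simp only [Matrix.single_apply_same, torusWeight, MonoidHom.coe_mk, OneHom.coe_mk,
      Units.val_mul]
    linear_combination (-(t.1 i : R) * r) * (t.1 j).inv_mul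
  · simp [hab]

theorem torusHom_commute_elemMat {n : ℕ} {R : Type*} [CommRing R] {i j : Fin n} (h : i ≠ j)
    {t : torus n R} (ht : torusWeight i j t = 1) (r : R) :
    Commute (torusHom n R t) (elemMat i j h r) := by
  have := torusHom_semiconj_elemMat h t r
  rwa [ht, Units.val_one, one_mul] at this

/-- The element of the torus with entry `u ^ (n - 1)` at `c` and `u⁻¹` elsewhere. -/
def torusElem {n : ℕ} {R : Type*} [CommRing R] (c : Fin n) (u : Rˣ) : torus n R :=
  ⟨Pi.mulSingle c (u ^ n) * fun _ => u⁻¹, by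
    simp [torus, Finset.prod_mul_distrib]⟩

theorem torusWeight_torusElem {n : ℕ} {R : Type*} [CommRing R] (i j c : Fin n) (u : Rˣ) :
    torusWeight i j (torusElem c u) =
      Pi.mulSingle (M := fun _ => Rˣ) c (u ^ n) i *
        (Pi.mulSingle (M := fun _ => Rˣ) c (u ^ n) j)⁻¹ := by
  simp [torusWeight, torusElem, mul_mul_mul_comm, mul_comm]

/-- The subgroup of the torus generated by the elements `torusElem c u`. -/
def torusPow (n : ℕ) (R : Type*) [CommRing R] : Subgroup (torus n R) :=
  Subgroup.closure {t | ∃ (c : Fin n) (u : Rˣ), t = torusElem c u}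

theorem torusElem_mem_torusPow {n : ℕ} {R : Type*} [CommRing R] (c : Fin n) (u : Rˣ) :
    torusElem c u ∈ torusPow n R :=
  Subgroup.subset_closure ⟨c, u, rfl⟩

theorem exists_mem_torusPow {n : ℕ} {R : Type*} [CommRing R] {i j k l : Fin n} (hkl : k ≠ l)
    (h₁ : ¬(k = i ∧ l = j)) (h₂ : ¬(k = j ∧ l = i)) (u : Rˣ) :
    ∃ t ∈ torusPow n R, torusWeight i j t = 1 ∧ torusWeight k l t = u ^ n := by
  by_cases hk : k ≠ i ∧ k ≠ j
  · refine ⟨_, torusElem_mem_torusPow k u, ?_, ?_⟩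
    · simp [torusWeight_torusElem, Pi.mulSingle_eq_of_ne hk.1.symm, Pi.mulSingle_eq_of_ne hk.2.symm]
    · simp [torusWeight_torusElem, Pi.mulSingle_eq_of_ne hkl.symm]
  · have hl : l ≠ i ∧ l ≠ j := by grind
    refine ⟨_, torusElem_mem_torusPow l u⁻¹, ?_, ?_⟩
    · simp [torusWeight_torusElem, Pi.mulSingle_eq_of_ne hl.1.symm, Pi.mulSingle_eq_of_ne hl.2.symm]
    · simp [torusWeight_torusElem, Pi.mulSingle_eq_of_ne hkl]


section Blocks

variable {n : ℕ} {R : Type*} [CommRing R] (S : Finset (Fin n))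

/-- The elementary matrices preserving both `S` and its complement. -/
def blockElems (R : Type*) [CommRing R] : Set (Matrix.SpecialLinearGroup (Fin n) R) :=
  {g | ∃ (i j : Fin n) (h : i ≠ j) (r : R), (i ∈ S ↔ j ∈ S) ∧ g = elemMat i j h r}

/-- The elementary matrices with row in `S` and column outside `S`. -/
def mixedElems (R : Type*) [CommRing R] : Set (Matrix.SpecialLinearGroup (Fin n) R) :=
  {g | ∃ (i j : Fin n) (h : i ≠ j) (r : R), (i ∈ S ∧ j ∉ S) ∧ g = elemMat i j h r}

/-- The Levi factor of the two-block parabolic subgroup attached to `S`. -/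
def blockLevi (R : Type*) [CommRing R] : Subgroup (Matrix.SpecialLinearGroup (Fin n) R) :=
  Subgroup.closure (diagMats n R ∪ blockElems S R)

/-- The two-block parabolic subgroup attached to `S`. -/
def blockParabolic (R : Type*) [CommRing R] : Subgroup (Matrix.SpecialLinearGroup (Fin n) R) :=
  Subgroup.closure (diagMats n R ∪ blockElems S R ∪ mixedElems S R)

/-- The diagonal projection onto the coordinates in `S`. -/
def blockProj (R : Type*) [CommRing R] : Matrix (Fin n) (Fin n) R :=
  Matrix.diagonal fun i => if i ∈ S then 1 else 0

/-- The matrices `N` whose nonzero entries have row in `S` and column outside `S`. -/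
def IsMixed (N : Matrix (Fin n) (Fin n) R) : Prop :=
  blockProj S R * N = N ∧ N * blockProj S R = 0

variable {S}

theorem isMixed_iff {N : Matrix (Fin n) (Fin n) R} :
    IsMixed S N ↔ ∀ i j, ¬(i ∈ S ∧ j ∉ S) → N i j = 0 := by
  simp only [IsMixed, blockProj, ← Matrix.ext_iff, Matrix.diagonal_mul, Matrix.mul_diagonal,
    Matrix.zero_apply]
  constructor
  · rintro ⟨h₁, h₂⟩ i j hij
    by_cases hi : i ∈ S
    · have hj : j ∈ S := by tauto
      simpa [hj] using h₂ i j
    · simpa [hi] using (h₁ i j).symm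
  · intro h
    refine ⟨fun i j => ?_, fun i j => ?_⟩
    · by_cases hi : i ∈ S
      · simp [hi]
      · simp [hi, h i j]
    · by_cases hj : j ∈ S
      · simp [hj, h i j]
      · simp [hj]

theorem IsMixed.mul_eq_zero {M N : Matrix (Fin n) (Fin n) R} (hM : IsMixed S M)
    (hN : IsMixed S N) : M * N = 0 := by
  rw [← hN.1, ← mul_assoc, hM.2, zero_mul]

theorem IsMixed.add {M N : Matrix (Fin n) (Fin n) R} (hM : IsMixed S M)
    (hN : IsMixed S N) : IsMixed S (M + N) :=
  ⟨by rw [mul_add, hM.1, hN.1], by rw [add_mul, hM.2, hN.2, add_zero]⟩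

theorem IsMixed.neg {N : Matrix (Fin n) (Fin n) R} (hN : IsMixed S N) : IsMixed S (-N) :=
  ⟨by rw [mul_neg, hN.1], by rw [neg_mul, hN.2, neg_zero]⟩

variable (S) in
/-- The unipotent radical of the two-block parabolic subgroup attached to `S`. -/
def unipotentRadical (R : Type*) [CommRing R] :
    Subgroup (Matrix.SpecialLinearGroup (Fin n) R) where
  carrier := {g | IsMixed S ((g : Matrix (Fin n) (Fin n) R) - 1)}
  one_mem' := by simp [IsMixed]
  mul_mem' {g h} hg hh := by
    have : ((g * h : Matrix.SpecialLinearGroup (Fin n) R) : Matrix (Fin n) (Fin n) R) - 1 =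
        ((g : Matrix (Fin n) (Fin n) R) - 1) + (h - 1) := by
      have := hg.mul_eq_zero hh
      rw [Matrix.SpecialLinearGroup.coe_mul]
      rw [← sub_eq_zero, ← this]
      noncomm_ring
    change IsMixed S _
    rw [this]
    exact hg.add hh
  inv_mem' {g} hg := by
    have h₂ : (g : Matrix (Fin n) (Fin n) R) * (2 - g) = 1 := by
      have := IsMixed.mul_eq_zero hg hg
      rw [← sub_eq_zero, ← neg_eq_zero, ← this]
      noncomm_ring
    have h₁ : ((g⁻¹ : Matrix.SpecialLinearGroup (Fin n) R) : Matrix (Fin n) (Fin n) R) * g = 1 := by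
      rw [← Matrix.SpecialLinearGroup.coe_mul, inv_mul_cancel, Matrix.SpecialLinearGroup.coe_one]
    change IsMixed S _
    rw [left_inv_eq_right_inv h₁ h₂, show (2 - g - 1 : Matrix (Fin n) (Fin n) R) = -(g - 1) by
      rw [← one_add_one_eq_two]; abel]
    exact IsMixed.neg hg

theorem mem_unipotentRadical {g : Matrix.SpecialLinearGroup (Fin n) R} :
    g ∈ unipotentRadical S R ↔ IsMixed S ((g : Matrix (Fin n) (Fin n) R) - 1) := Iff.rfl

theorem elemMat_mem_unipotentRadical {i j : Fin n} (h : i ≠ j) (hi : i ∈ S) (hj : j ∉ S) (r : R) :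
    elemMat i j h r ∈ unipotentRadical S R := by
  rw [mem_unipotentRadical, coe_elemMat, add_sub_cancel_left, isMixed_iff]
  intro a b hab
  exact Matrix.single_apply_of_ne _ _ _ _ _ (by rintro ⟨rfl, rfl⟩; exact hab ⟨hi, hj⟩)

theorem commute_blockProj {g : Matrix.SpecialLinearGroup (Fin n) R} (hg : g ∈ blockLevi S R) :
    Commute (g : Matrix (Fin n) (Fin n) R) (blockProj S R) := by
  induction hg using Subgroup.closure_induction with
  | mem g hg =>
    obtain hg | ⟨i, j, h, r, hij, rfl⟩ := hg
    · rw [← Matrix.IsDiag.diagonal_diag hg, blockProj]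
      exact Matrix.commute_diagonal _ _
    · rw [coe_elemMat]
      refine (Commute.one_left _).add_left ?_
      ext a b
      rw [blockProj, Matrix.diagonal_mul, Matrix.mul_diagonal]
      by_cases hab : i = a ∧ j = b
      · obtain ⟨rfl, rfl⟩ := hab
        simp [hij]
      · simp [hab]
  | one => exact Commute.one_left _
  | mul g h _ _ hg hh => exact hg.mul_left hh
  | inv g _ hg =>
    have h₁ : ((g⁻¹ : Matrix.SpecialLinearGroup (Fin n) R) : Matrix (Fin n) (Fin n) R) * g = 1 := by
      rw [← Matrix.SpecialLinearGroup.coe_mul, inv_mul_cancel, Matrix.SpecialLinearGroup.coe_one]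
    have h₂ : (g : Matrix (Fin n) (Fin n) R) * (g⁻¹ : Matrix.SpecialLinearGroup (Fin n) R) = 1 := by
      rw [← Matrix.SpecialLinearGroup.coe_mul, mul_inv_cancel, Matrix.SpecialLinearGroup.coe_one]
    let u : (Matrix (Fin n) (Fin n) R)ˣ :=
      ⟨g, (g⁻¹ : Matrix.SpecialLinearGroup (Fin n) R), h₂, h₁⟩
    exact Commute.units_inv_left (u := u) hg

theorem blockLevi_le_normalizer :
    blockLevi S R ≤ Subgroup.normalizer (unipotentRadical S R : Set _) := by
  have key {g : Matrix.SpecialLinearGroup (Fin n) R} (hg : g ∈ blockLevi S R)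
      {u : Matrix.SpecialLinearGroup (Fin n) R} (hu : u ∈ unipotentRadical S R) :
      g * u * g⁻¹ ∈ unipotentRadical S R := by
    have h₁ := (commute_blockProj hg).eq
    have h₂ := (commute_blockProj (inv_mem hg)).eq
    rw [mem_unipotentRadical] at hu ⊢
    have h : ((g * u * g⁻¹ : Matrix.SpecialLinearGroup (Fin n) R) : Matrix (Fin n) (Fin n) R) - 1 =
        g * ((u : Matrix (Fin n) (Fin n) R) - 1) * (g⁻¹ : Matrix.SpecialLinearGroup (Fin n) R) := by
      rw [mul_sub, sub_mul, mul_one, ← Matrix.SpecialLinearGroup.coe_mul,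
        ← Matrix.SpecialLinearGroup.coe_mul, ← Matrix.SpecialLinearGroup.coe_mul, mul_inv_cancel,
        Matrix.SpecialLinearGroup.coe_one]
    rw [h]
    constructor
    · rw [← mul_assoc, ← mul_assoc, ← h₁, mul_assoc _ (blockProj S R), hu.1]
    · rw [mul_assoc, h₂, ← mul_assoc, mul_assoc _ _ (blockProj S R), hu.2, mul_zero, zero_mul]
  intro g hg
  rw [Subgroup.mem_normalizer_iff]
  refine fun u => ⟨key hg, fun h => ?_⟩
  simpa [mul_assoc] using key (inv_mem hg) h

theorem eq_one_of_mem_blockLevi_of_mem_unipotentRadical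
    {g : Matrix.SpecialLinearGroup (Fin n) R} (hg : g ∈ blockLevi S R)
    (hu : g ∈ unipotentRadical S R) : g = 1 := by
  have h₁ := (commute_blockProj hg).eq
  rw [mem_unipotentRadical] at hu
  refine specialLinearGroup_ext (sub_eq_zero.mp ?_)
  rw [Matrix.SpecialLinearGroup.coe_one, ← hu.1, mul_sub, ← h₁, mul_one]
  simpa [sub_mul] using hu.2

variable (S) in
/-- The indices of the root subgroups of the unipotent radical. -/
abbrev MixedRoot : Type := {p : Fin n × Fin n // p.1 ∈ S ∧ p.2 ∉ S}

theorem MixedRoot.ne (p : MixedRoot S) : p.1.1 ≠ p.1.2 := fun h => p.2.2 (h ▸ p.2.1)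

variable (S) in
/-- The matrix with prescribed entries in the rows in `S` and columns outside `S`. -/
def mixedMatrix (v : MixedRoot S → Multiplicative R) : Matrix (Fin n) (Fin n) R :=
  Matrix.of fun i j => if h : i ∈ S ∧ j ∉ S then (v ⟨(i, j), h⟩).toAdd else 0

theorem isMixed_mixedMatrix (v : MixedRoot S → Multiplicative R) : IsMixed S (mixedMatrix S v) :=
  isMixed_iff.mpr fun _ _ h => dif_neg h

variable (S R) in
/-- The parametrization of the unipotent radical by its entries. -/
def mixedMatrixHom : (MixedRoot S → Multiplicative R) →* Matrix (Fin n) (Fin n) R where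
  toFun v := 1 + mixedMatrix S v
  map_one' := by
    ext i j
    simp [mixedMatrix]
  map_mul' v w := by
    have h₁ := (isMixed_mixedMatrix v).mul_eq_zero (isMixed_mixedMatrix w)
    have h₂ : mixedMatrix S (v * w) = mixedMatrix S v + mixedMatrix S w := by
      ext i j
      by_cases h : i ∈ S ∧ j ∉ S <;> simp [mixedMatrix, h]
    rw [h₂, add_mul, mul_add, mul_add, h₁]
    noncomm_ring

/-- Pairwise commuting lifts of the root subgroups of the unipotent radical generate a lift of the
whole unipotent radical. -/
theorem unipotentRadical_lift {H : Type*} [Group H]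
    (π : H →* Matrix.SpecialLinearGroup (Fin n) R) (x : MixedRoot S → Multiplicative R →* H)
    (hx : ∀ p r, π (x p r) = elemMat p.1.1 p.1.2 p.ne r.toAdd)
    (hcomm : Pairwise fun p q => ∀ r s, Commute (x p r) (x q s)) :
    (∀ w ∈ ⨆ p, (x p).range, π w = 1 → w = 1) ∧
      (⨆ p, (x p).range).map π = unipotentRadical S R := by
  classical
  let X := MonoidHom.noncommPiCoprod x hcomm
  have hX (v) : (π (X v) : Matrix (Fin n) (Fin n) R) = 1 + mixedMatrix S v := by
    suffices (Matrix.SpecialLinearGroup.coeMonoidHom.comp π).comp X = mixedMatrixHom R S from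
      DFunLike.congr_fun this v
    refine MonoidHom.pi_ext fun p r => ?_
    have h₁ : X (Pi.mulSingle p r) = x p r := MonoidHom.noncommPiCoprod_mulSingle ..
    simp only [MonoidHom.comp_apply, h₁, hx, Matrix.SpecialLinearGroup.coeMonoidHom_apply,
      coe_elemMat, mixedMatrixHom, MonoidHom.coe_mk, OneHom.coe_mk]
    congr 1
    ext i j
    by_cases hp : p.1.1 = i ∧ p.1.2 = j
    · obtain ⟨rfl, rfl⟩ := hp
      simp [mixedMatrix, p.2]
    · rw [Matrix.single_apply_of_ne _ _ _ _ _ hp, mixedMatrix, Matrix.of_apply]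
      split_ifs with h
      · rw [Pi.mulSingle_eq_of_ne (by rintro rfl; exact hp ⟨rfl, rfl⟩), toAdd_one]
      · rfl
  have hrange : X.range = ⨆ p, (x p).range := MonoidHom.noncommPiCoprod_range _
  rw [← hrange]
  constructor
  · rintro _ ⟨v, rfl⟩ hv
    have h := hX v
    rw [hv, Matrix.SpecialLinearGroup.coe_one, left_eq_add] at h
    have : v = 1 := funext fun p => by
      simpa [mixedMatrix, p.2] using congrFun (congrFun h p.1.1) p.1.2
    rw [this, map_one]
  · ext g
    simp only [Subgroup.mem_map, MonoidHom.mem_range, exists_exists_eq_and]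
    constructor
    · rintro ⟨v, rfl⟩
      rw [mem_unipotentRadical, hX, add_sub_cancel_left]
      exact isMixed_mixedMatrix v
    · intro hg
      refine ⟨fun p => .ofAdd ((g : Matrix (Fin n) (Fin n) R) p.1.1 p.1.2), specialLinearGroup_ext
        ?_⟩
      rw [hX, ← eq_sub_iff_add_eq']
      ext i j
      rw [mixedMatrix, Matrix.of_apply]
      split_ifs with h
      · have hij : i ≠ j := fun h' => h.2 (h' ▸ h.1)
        simp [hij]
      · exact (isMixed_iff.mp hg i j h).symm

theorem elemMat_commute_of_mixed (p q : MixedRoot S) (r s : R) :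
    Commute (elemMat p.1.1 p.1.2 p.ne r) (elemMat q.1.1 q.1.2 q.ne s) :=
  elemMat_commute _ _ (fun h => p.2.2 (by rw [h]; exact q.2.1))
    (fun h => q.2.2 (by rw [← h]; exact p.2.1)) r s

theorem unipotentRadical_le_closure :
    unipotentRadical S R ≤ Subgroup.closure (mixedElems S R) := by
  let x (p : MixedRoot S) : Multiplicative R →* Matrix.SpecialLinearGroup (Fin n) R :=
    { toFun := fun r => elemMat p.1.1 p.1.2 p.ne r.toAdd
      map_one' := elemMat_zero ..
      map_mul' := fun _ _ => elemMat_add .. }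
  have h := (unipotentRadical_lift (MonoidHom.id _) x (fun _ _ => rfl)
    fun p q _ r s => elemMat_commute_of_mixed p q r.toAdd s.toAdd).2
  rw [Subgroup.map_id] at h
  rw [← h, iSup_le_iff]
  rintro p _ ⟨r, rfl⟩
  exact Subgroup.subset_closure ⟨_, _, p.ne, _, p.2, rfl⟩

theorem blockLevi_le_blockParabolic : blockLevi S R ≤ blockParabolic S R :=
  Subgroup.closure_mono Set.subset_union_left

theorem blockParabolic_eq_sup : blockParabolic S R = blockLevi S R ⊔ unipotentRadical S R := by
  rw [blockParabolic, Subgroup.closure_union]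
  refine congrArg _ (le_antisymm ?_ unipotentRadical_le_closure)
  rw [Subgroup.closure_le]
  rintro _ ⟨i, j, h, r, ⟨hi, hj⟩, rfl⟩
  exact elemMat_mem_unipotentRadical h hi hj r

theorem exists_of_mem_blockParabolic {g : Matrix.SpecialLinearGroup (Fin n) R}
    (hg : g ∈ blockParabolic S R) : ∃ l ∈ blockLevi S R, ∃ u ∈ unipotentRadical S R, l * u = g := by
  rwa [blockParabolic_eq_sup, ← SetLike.mem_coe,
    Subgroup.coe_mul_of_left_le_normalizer_right _ _ blockLevi_le_normalizer] at hg

theorem unipotentRadical_le_blockParabolic : unipotentRadical S R ≤ blockParabolic S R := by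
  rw [blockParabolic_eq_sup]
  exact le_sup_right

end Blocks

section Lift

theorem SemiconjBy.commutatorElement {G : Type*} [Group G] {a x y x' y' : G}
    (h : SemiconjBy a x y) (h' : SemiconjBy a x' y') : SemiconjBy a ⁅x, x'⁆ ⁅y, y'⁆ :=
  ((h.mul_right h').mul_right h.inv_right).mul_right h'.inv_right

theorem SemiconjBy.commute {G : Type*} [Group G] {a x y x' y' : G}
    (h : SemiconjBy a x y) (h' : SemiconjBy a x' y') (hx : Commute x x') : Commute y y' := by
  have H := hx.map (MulAut.conj a).toMonoidHom
  simpa [h.eq, h'.eq] using H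

variable {n : ℕ} {R : Type*} [CommRing R]

/-- A homomorphism `π` onto the two-block parabolic subgroup attached to `S`, with lifts of the
Levi factor and of generators `ξ i j` of its unipotent radical. The set `A` generates `R` up to
`n`-th powers of units and `T` generates the kernels of the roots on the torus. -/
structure ParabolicLift (S : Finset (Fin n)) {H : Type*} [Group H]
    (π : H →* Matrix.SpecialLinearGroup (Fin n) R) (A : Set R) (T : Set (torus n R)) where
  /-- the lift of the torus -/
  δ : torus n R →* H
  /-- the lifts of the elementary matrices of the Levi factor -/
  e : Fin n → Fin n → R → H
  /-- the lifts of the generators of the unipotent radical -/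
  ξ : Fin n → Fin n → H
  /-- an auxiliary second index in `S` -/
  m : Fin n → Fin n
  m_mem : ∀ i, m i ∈ S
  m_ne : ∀ i, m i ≠ i
  π_δ : ∀ t, π (δ t) = torusHom n R t
  π_e : ∀ i j (h : i ≠ j) r, (i ∈ S ↔ j ∈ S) → π (e i j r) = elemMat i j h r
  π_ξ : ∀ i j (h : i ≠ j), (i ∈ S ∧ j ∉ S) → π (ξ i j) = elemMat i j h 1
  π_ξ_of_not : ∀ i j, ¬(i ∈ S ∧ j ∉ S) → π (ξ i j) = 1
  e_add : ∀ i j, i ≠ j → (i ∈ S ↔ j ∈ S) → ∀ r s, e i j (r + s) = e i j r * e i j s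
  δ_e : ∀ i j, i ≠ j → (i ∈ S ↔ j ∈ S) → ∀ t r,
    SemiconjBy (δ t) (e i j r) (e i j (torusWeight i j t * r))
  generate : Subgroup.closure (Set.range δ ∪ {h | ∃ i j r, i ≠ j ∧ (i ∈ S ↔ j ∈ S) ∧ h = e i j r} ∪
    {h | ∃ i j, h = ξ i j}) = ⊤
  injective : ∀ l ∈ Subgroup.closure
    (Set.range δ ∪ {h | ∃ i j r, i ≠ j ∧ (i ∈ S ↔ j ∈ S) ∧ h = e i j r}), π l = 1 → l = 1
  span : AddSubmonoid.closure {r : R | ∃ u : Rˣ, ∃ a ∈ A, r = (u ^ n : Rˣ) * a} = ⊤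
  ker_le : ∀ i j : Fin n,
    (torusWeight i j).ker ≤ Subgroup.closure {t : torus n R | t ∈ T ∧ torusWeight i j t = 1}

namespace ParabolicLift

variable {S : Finset (Fin n)} {H : Type*} [Group H]
  {π : H →* Matrix.SpecialLinearGroup (Fin n) R} {A : Set R} {T : Set (torus n R)}
  (D : ParabolicLift S π A T)

/-- The lifts of the elementary matrices of the unipotent radical. -/
def x (i j : Fin n) (r : R) : H := ⁅D.e i (D.m i) r, D.ξ (D.m i) j⁆

/-- The finite set of elements whose mutual relations present the parabolic subgroup. -/
def testSet : Set H :=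
  D.δ '' T ∪ {h | ∃ i j, ∃ a ∈ A, h = D.e i j a} ∪ {h | ∃ i j, h = D.ξ i j} ∪
    {h | ∃ i j, ∃ a ∈ A, h = D.x i j a} ∪ {1}

/-- The lift of the unipotent radical. -/
def radical : Subgroup H :=
  Subgroup.closure {h | ∃ i j r, (i ∈ S ∧ j ∉ S) ∧ h = D.x i j r}

/-- The relations between the elements of the test set that hold in the parabolic subgroup. -/
structure Relations : Prop where
  commute : ∀ y ∈ D.testSet, ∀ z ∈ D.testSet, Commute (π y) (π z) → Commute y z
  conj_mem : ∀ y ∈ D.testSet, ∀ z ∈ D.testSet, π (y * z * y⁻¹) ∈ unipotentRadical S R →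
    y * z * y⁻¹ ∈ D.radical

theorem δ_mem {t : torus n R} (ht : t ∈ T) : D.δ t ∈ D.testSet :=
  .inl <| .inl <| .inl <| .inl ⟨t, ht, rfl⟩

theorem e_mem (i j : Fin n) {a : R} (ha : a ∈ A) : D.e i j a ∈ D.testSet :=
  .inl <| .inl <| .inl <| .inr ⟨i, j, a, ha, rfl⟩

theorem ξ_mem (i j : Fin n) : D.ξ i j ∈ D.testSet :=
  .inl <| .inl <| .inr ⟨i, j, rfl⟩

theorem x_mem (i j : Fin n) {a : R} (ha : a ∈ A) : D.x i j a ∈ D.testSet :=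
  .inl <| .inr ⟨i, j, a, ha, rfl⟩

theorem one_mem : 1 ∈ D.testSet := .inr rfl

theorem induction_span (D : ParabolicLift S π A T) {p : R → Prop} (zero : p 0)
    (add : ∀ r s, p r → p s → p (r + s))
    (mem : ∀ u : Rˣ, ∀ a ∈ A, p ((u ^ n : Rˣ) * a)) (r : R) : p r := by
  have hr : r ∈ AddSubmonoid.closure {r : R | ∃ u : Rˣ, ∃ a ∈ A, r = (u ^ n : Rˣ) * a} :=
    D.span ▸ AddSubmonoid.mem_top r
  induction hr using AddSubmonoid.closure_induction with
  | mem r hr =>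
    obtain ⟨u, a, ha, rfl⟩ := hr
    exact mem u a ha
  | zero => exact zero
  | add r s _ _ hr hs => exact add r s hr hs

theorem e_zero {i j : Fin n} (h : i ≠ j) (hS : i ∈ S ↔ j ∈ S) : D.e i j 0 = 1 := by
  simpa using D.e_add i j h hS 0 0

theorem π_x {i j : Fin n} (h : i ≠ j) (hi : i ∈ S) (hj : j ∉ S) (r : R) :
    π (D.x i j r) = elemMat i j h r := by
  have hm : D.m i ≠ j := fun h' => hj (h' ▸ D.m_mem i)
  have hmi := (D.m_ne i).symm
  rw [x, map_commutatorElement, D.π_e _ _ hmi _ (iff_of_true hi (D.m_mem i)),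
    D.π_ξ _ _ hm ⟨D.m_mem i, hj⟩, elemMat_commutator hmi hm h, mul_one]

theorem x_zero {i j : Fin n} (hi : i ∈ S) : D.x i j 0 = 1 := by
  rw [x, D.e_zero (D.m_ne i).symm (iff_of_true hi (D.m_mem i)), commutatorElement_one_left]

variable {D}

/-- An element of the test set whose image is centralized by the kernel of a root is centralized by
the lift of that kernel. -/
theorem Relations.commute_δ (hD : D.Relations) {i j : Fin n} {y : H} (hy : y ∈ D.testSet)
    (h : ∀ t, torusWeight i j t = 1 → Commute (torusHom n R t) (π y)) (t : torus n R)
    (ht : torusWeight i j t = 1) : Commute (D.δ t) y := by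
  suffices (torusWeight i j).ker ≤ (Subgroup.centralizer {y}).comap D.δ from
    Commute.symm (Subgroup.mem_centralizer_singleton_iff.mp (this ht)).symm
  refine (D.ker_le i j).trans ((Subgroup.closure_le _).mpr fun s hs => ?_)
  refine Subgroup.mem_centralizer_singleton_iff.mpr ?_
  exact (hD.commute _ (D.δ_mem hs.1) _ hy (by rw [D.π_δ]; exact h s hs.2)).symm.eq.symm

theorem Relations.semiconj_x (hD : D.Relations) {i j : Fin n} (hi : i ∈ S) (hj : j ∉ S) (r : R)
    {t : torus n R}
    (ht : torusWeight (D.m i) j t = 1) :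
    SemiconjBy (D.δ t) (D.x i j r) (D.x i j (torusWeight i j t * r)) := by
  have hm : D.m i ≠ j := fun h' => hj (h' ▸ D.m_mem i)
  have h₁ : Commute (D.δ t) (D.ξ (D.m i) j) := by
    refine hD.commute_δ (D.ξ_mem _ _) (fun t ht => ?_) t ht
    rw [D.π_ξ _ _ hm ⟨D.m_mem i, hj⟩]
    exact torusHom_commute_elemMat hm ht 1
  have h₂ := D.δ_e _ _ (D.m_ne i).symm (iff_of_true hi (D.m_mem i)) t r
  rw [← torusWeight_mul_torusWeight i (D.m i) j, ht, mul_one]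
  exact h₂.commutatorElement h₁

theorem Relations.commute_δ_x (hD : D.Relations) {i j : Fin n} (hi : i ∈ S) (hj : j ∉ S) {a : R}
    (ha : a ∈ A)
    {t : torus n R} (ht : torusWeight i j t = 1) : Commute (D.δ t) (D.x i j a) := by
  have h : i ≠ j := fun h => hj (h ▸ hi)
  refine hD.commute_δ (D.x_mem i j ha) (fun t ht => ?_) t ht
  rw [D.π_x h hi hj]
  exact torusHom_commute_elemMat h ht a

theorem torusWeight_torusElem_left {i j : Fin n} (h : i ≠ j) (u : Rˣ) :
    torusWeight i j (torusElem i u) = u ^ n := by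
  simp [torusWeight_torusElem, Pi.mulSingle_eq_of_ne h.symm]

theorem torusWeight_torusElem_of_ne {i j c : Fin n} (hi : i ≠ c) (hj : j ≠ c) (u : Rˣ) :
    torusWeight i j (torusElem c u) = 1 := by
  simp [torusWeight_torusElem, Pi.mulSingle_eq_of_ne hi, Pi.mulSingle_eq_of_ne hj]

theorem Relations.semiconj_torusElem (hD : D.Relations) {i j : Fin n} (hi : i ∈ S) (hj : j ∉ S)
    (r : R) (u : Rˣ) :
    SemiconjBy (D.δ (torusElem i u)) (D.x i j r) (D.x i j ((u ^ n : Rˣ) * r)) := by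
  have h : i ≠ j := fun h => hj (h ▸ hi)
  rw [← torusWeight_torusElem_left h]
  exact hD.semiconj_x hi hj r (torusWeight_torusElem_of_ne (D.m_ne i) h.symm u)

theorem x_add_of_commute {i j : Fin n} (hi : i ∈ S) {r s : R}
    (h : Commute (D.e i (D.m i) r) (D.x i j s)) : D.x i j (r + s) = D.x i j s * D.x i j r := by
  have h' : D.x i j (r + s) = D.e i (D.m i) r * D.x i j s * (D.e i (D.m i) r)⁻¹ * D.x i j r := by
    simp only [x, D.e_add _ _ (D.m_ne i).symm (iff_of_true hi (D.m_mem i)), commutatorElement_def]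
    group
  rw [h', h.eq, mul_inv_cancel_right]

theorem Relations.commute_e_x (hD : D.Relations) {i j : Fin n} (hi : i ∈ S) (hj : j ∉ S) (r s : R) :
    Commute (D.e i (D.m i) r) (D.x i j s) := by
  have h : i ≠ j := fun h => hj (h ▸ hi)
  have hm : D.m i ≠ j := fun h' => hj (h' ▸ D.m_mem i)
  have hmi := (D.m_ne i).symm
  have hS := iff_of_true hi (D.m_mem i)
  induction s using D.induction_span generalizing r with
  | zero => rw [D.x_zero hi]; exact Commute.one_right _
  | add s s' hs hs' =>
    rw [D.x_add_of_commute hi (hs' s)]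
    exact (hs' r).mul_right (hs r)
  | mem u a ha =>
    have key (r : R) : Commute (D.e i (D.m i) r) (D.x i j a) := by
      induction r using D.induction_span with
      | zero => rw [D.e_zero hmi hS]; exact Commute.one_left _
      | add r r' hr hr' => rw [D.e_add _ _ hmi hS]; exact hr.mul_left hr'
      | mem v b hb =>
        obtain ⟨t, -, h₁, h₂⟩ := exists_mem_torusPow (R := R) (i := i) (j := j) hmi
          (fun h => hm h.2) (fun h' => h h'.1) v
        rw [← h₂]
        refine (D.δ_e _ _ hmi hS t b).commute (hD.commute_δ_x hi hj ha h₁) ?_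
        refine hD.commute _ (D.e_mem _ _ hb) _ (D.x_mem _ _ ha) ?_
        rw [D.π_x h hi hj, D.π_e _ _ hmi _ hS]
        exact elemMat_commute _ _ hmi.symm h _ _
    have := (D.δ_e _ _ hmi hS (torusElem i u) (((u ^ n)⁻¹ : Rˣ) * r)).commute
      (hD.semiconj_torusElem hi hj a u) (key _)
    rwa [torusWeight_torusElem_left hmi, Units.mul_inv_cancel_left] at this

theorem Relations.x_add (hD : D.Relations) {i j : Fin n} (hi : i ∈ S) (hj : j ∉ S) (r s : R) :
    D.x i j (r + s) = D.x i j r * D.x i j s := by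
  rw [add_comm, D.x_add_of_commute hi (hD.commute_e_x hi hj s r)]

theorem Relations.commute_δ_x_of_torusWeight (hD : D.Relations) {i j : Fin n} (hi : i ∈ S)
    (hj : j ∉ S)
    {t : torus n R} (ht : torusWeight i j t = 1) (r : R) : Commute (D.δ t) (D.x i j r) := by
  induction r using D.induction_span with
  | zero => rw [D.x_zero hi]; exact Commute.one_right _
  | add r s hr hs => rw [hD.x_add hi hj]; exact hr.mul_right hs
  | mem u a ha =>
    have h : SemiconjBy (D.δ (torusElem i u)) (D.δ t) (D.δ t) := (Commute.all _ _).map D.δ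
    exact h.commute (hD.semiconj_torusElem hi hj a u) (hD.commute_δ_x hi hj ha ht)

variable (D) in
/-- The elements of the torus acting on the lift of a root subgroup by the root. -/
def covariant (i j : Fin n) : Subgroup (torus n R) where
  carrier := {t | ∀ r, SemiconjBy (D.δ t) (D.x i j r) (D.x i j (torusWeight i j t * r))}
  one_mem' r := by simp
  mul_mem' {s t} hs ht r := by
    rw [map_mul, map_mul, Units.val_mul, mul_assoc]
    exact (hs _).mul_left (ht r)
  inv_mem' {t} ht r := by
    have := (ht (((torusWeight i j t)⁻¹ : Rˣ) * r)).inv_symm_left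
    simpa using this

theorem Relations.torusPow_le_covariant (hD : D.Relations) {i j : Fin n} (hi : i ∈ S) (hj : j ∉ S) :
    torusPow n R ≤ D.covariant i j := by
  have h : i ≠ j := fun h => hj (h ▸ hi)
  have h₀ {t : torus n R} (ht : torusWeight i j t = 1) : t ∈ D.covariant i j := fun r => by
    rw [ht, Units.val_one, one_mul]
    exact hD.commute_δ_x_of_torusWeight hi hj ht r
  have h₁ (u : Rˣ) : torusElem i u ∈ D.covariant i j := fun r => by
    rw [torusWeight_torusElem_left h]
    exact hD.semiconj_torusElem hi hj r u
  refine (Subgroup.closure_le _).mpr ?_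
  rintro _ ⟨c, u, rfl⟩
  by_cases hic : i = c
  · exact hic ▸ h₁ u
  by_cases hjc : j = c
  · subst hjc
    have : torusElem i u * torusElem j u ∈ D.covariant i j := h₀ (by
      simp [torusWeight_torusElem, Pi.mulSingle_eq_of_ne h, Pi.mulSingle_eq_of_ne h.symm])
    exact (Subgroup.mul_mem_cancel_left _ (h₁ u)).mp this
  · exact h₀ (torusWeight_torusElem_of_ne hic hjc u)

theorem Relations.commute_x_x (hD : D.Relations) {p q : MixedRoot S} (hpq : p ≠ q) (r s : R) :
    Commute (D.x p.1.1 p.1.2 r) (D.x q.1.1 q.1.2 s) := by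
  obtain ⟨⟨i, j⟩, hi, hj⟩ := p
  obtain ⟨⟨k, l⟩, hk, hl⟩ := q
  have hne : ¬(k = i ∧ l = j) := by
    rintro ⟨rfl, rfl⟩
    exact hpq rfl
  have hne' : ¬(i = k ∧ j = l) := fun h => hne ⟨h.1.symm, h.2.symm⟩
  have hik : i ≠ l := fun h => hl (h ▸ hi)
  have hkl : k ≠ l := fun h => hl (h ▸ hk)
  have hij : i ≠ j := fun h => hj (h ▸ hi)
  dsimp only at *
  induction r using D.induction_span with
  | zero => rw [D.x_zero hi]; exact Commute.one_left _
  | add r r' hr hr' => rw [hD.x_add hi hj]; exact hr.mul_left hr'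
  | mem u a ha =>
    obtain ⟨t, ht, h₁, h₂⟩ := exists_mem_torusPow (R := R) hij hne' (fun h => hik h.1) u
    have h₃ := hD.torusPow_le_covariant hi hj ht a
    rw [h₂] at h₃
    refine h₃.commute (hD.commute_δ_x_of_torusWeight hk hl h₁ s) ?_
    induction s using D.induction_span with
    | zero => rw [D.x_zero hk]; exact Commute.one_right _
    | add s s' hs hs' => rw [hD.x_add hk hl]; exact hs.mul_right hs'
    | mem v b hb =>
      obtain ⟨t, ht, h₁, h₂⟩ := exists_mem_torusPow (R := R) hkl hne (fun h => hik h.2.symm) v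
      have h₃ := hD.torusPow_le_covariant hk hl ht b
      rw [h₂] at h₃
      refine SemiconjBy.commute (hD.commute_δ_x_of_torusWeight hi hj h₁ a) h₃ ?_
      refine hD.commute _ (D.x_mem _ _ ha) _ (D.x_mem _ _ hb) ?_
      rw [D.π_x hij hi hj, D.π_x hkl hk hl]
      exact elemMat_commute hij hkl (fun h => hj (h ▸ hk)) hik _ _

theorem Relations.radical_aux (hD : D.Relations) :
    (∀ w ∈ D.radical, π w = 1 → w = 1) ∧ D.radical.map π = unipotentRadical S R := by
  let x (p : MixedRoot S) : Multiplicative R →* H :=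
    { toFun r := D.x p.1.1 p.1.2 r.toAdd
      map_one' := D.x_zero p.2.1
      map_mul' r s := hD.x_add p.2.1 p.2.2 r.toAdd s.toAdd }
  have hx : D.radical = ⨆ p, (x p).range := by
    refine le_antisymm ((Subgroup.closure_le _).mpr ?_) (iSup_le ?_)
    · rintro _ ⟨i, j, r, hij, rfl⟩
      exact Subgroup.mem_iSup_of_mem ⟨(i, j), hij⟩ ⟨.ofAdd r, rfl⟩
    · rintro p _ ⟨r, rfl⟩
      exact Subgroup.subset_closure ⟨_, _, _, p.2, rfl⟩
  rw [hx]
  exact unipotentRadical_lift π x (fun p r => D.π_x p.ne p.2.1 p.2.2 r.toAdd)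
    fun p q hpq r s => hD.commute_x_x hpq r.toAdd s.toAdd

theorem x_mem_radical {i j : Fin n} (hi : i ∈ S) (hj : j ∉ S) (r : R) : D.x i j r ∈ D.radical :=
  Subgroup.subset_closure ⟨i, j, r, ⟨hi, hj⟩, rfl⟩

theorem Relations.conj_mem_radical (hD : D.Relations) {y : H}
    (h : ∀ i ∈ S, ∀ j ∉ S, ∀ (u : Rˣ), ∀ a ∈ A,
      y * D.x i j ((u ^ n : Rˣ) * a) * y⁻¹ ∈ D.radical) {w : H} (hw : w ∈ D.radical) :
    y * w * y⁻¹ ∈ D.radical := by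
  suffices D.radical ≤ D.radical.comap (MulAut.conj y).toMonoidHom from this hw
  refine (Subgroup.closure_le _).mpr ?_
  rintro _ ⟨i, j, r, ⟨hi, hj⟩, rfl⟩
  induction r using D.induction_span with
  | zero => rw [D.x_zero hi]; exact Subgroup.one_mem _
  | add r s hr hs => rw [hD.x_add hi hj]; exact Subgroup.mul_mem _ hr hs
  | mem u a ha => exact h i hi j hj u a ha

theorem Relations.conj_x_mem_radical (hD : D.Relations) {y : H} (hy : y ∈ D.testSet)
    (hy' : π y ∈ blockLevi S R)
    {i j : Fin n} (hi : i ∈ S) (hj : j ∉ S) {a : R} (ha : a ∈ A) :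
    y * D.x i j a * y⁻¹ ∈ D.radical := by
  refine hD.conj_mem y hy _ (D.x_mem i j ha) ?_
  have h : i ≠ j := fun h => hj (h ▸ hi)
  rw [map_mul, map_mul, map_inv, D.π_x h hi hj]
  exact (Subgroup.mem_normalizer_iff.mp (blockLevi_le_normalizer hy') _).mp
    (elemMat_mem_unipotentRadical h hi hj a)

theorem torusHom_mem_blockLevi (t : torus n R) : torusHom n R t ∈ blockLevi S R :=
  Subgroup.subset_closure <| .inl <| by
    rw [← range_torusHom]
    exact ⟨t, rfl⟩

theorem Relations.mem_covariant (hD : D.Relations) {i j : Fin n} (hi : i ∈ S) (hj : j ∉ S)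
    (t : torus n R) :
    t ∈ D.covariant i j := by
  have h : i ≠ j := fun h => hj (h ▸ hi)
  suffices Subgroup.closure {t | t ∈ T ∧ torusWeight i i t = 1} ≤ D.covariant i j from
    this (D.ker_le i i (by simp [MonoidHom.mem_ker, torusWeight]))
  refine (Subgroup.closure_le _).mpr fun t ht r => ?_
  have hy : π (D.δ t) ∈ blockLevi S R := by
    rw [D.π_δ]
    exact torusHom_mem_blockLevi t
  induction r using D.induction_span with
  | zero => rw [mul_zero, D.x_zero hi]; exact SemiconjBy.one_right _
  | add r s hr hs => rw [mul_add, hD.x_add hi hj, hD.x_add hi hj]; exact hr.mul_right hs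
  | mem u a ha =>
    have h₁ := hD.conj_x_mem_radical (D.δ_mem ht.1) hy hi hj ha
    have h₂ : SemiconjBy (D.δ t) (D.x i j a) (D.x i j (torusWeight i j t * a)) := by
      rw [SemiconjBy, ← mul_inv_eq_iff_eq_mul, ← mul_inv_eq_one]
      refine hD.radical_aux.1 _ (mul_mem h₁ (inv_mem (D.x_mem_radical hi hj _))) ?_
      rw [map_mul, map_inv, mul_inv_eq_one, map_mul, map_mul, map_inv, D.π_δ, D.π_x h hi hj,
        D.π_x h hi hj, mul_inv_eq_iff_eq_mul]
      exact torusHom_semiconj_elemMat h t a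
    have h₃ := hD.torusPow_le_covariant hi hj (torusElem_mem_torusPow i u)
    have h₄ := h₃ a
    have h₅ := ((h₃ (torusWeight i j t * a)).mul_left h₂).mul_left h₄.inv_symm_left
    rw [torusWeight_torusElem_left h] at h₅
    rwa [← map_inv, ← map_mul, ← map_mul, mul_comm _ t, mul_inv_cancel_right, mul_left_comm] at h₅

theorem Relations.δ_conj_mem (hD : D.Relations) (t : torus n R) {w : H} (hw : w ∈ D.radical) :
    D.δ t * w * (D.δ t)⁻¹ ∈ D.radical := by
  refine hD.conj_mem_radical (fun i hi j hj u a _ => ?_) hw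
  rw [mul_inv_eq_iff_eq_mul.mpr (hD.mem_covariant hi hj t _)]
  exact D.x_mem_radical hi hj _

theorem Relations.e_conj_mem (hD : D.Relations) {k l : Fin n} (hkl : k ≠ l) (hS : k ∈ S ↔ l ∈ S)
    (r : R) {w : H}
    (hw : w ∈ D.radical) : D.e k l r * w * (D.e k l r)⁻¹ ∈ D.radical := by
  induction r using D.induction_span generalizing w with
  | zero => simpa [D.e_zero hkl hS] using hw
  | add r s hr hs =>
    rw [D.e_add _ _ hkl hS]
    simpa [mul_assoc] using hr (hs hw)
  | mem v b hb =>
    have key {w : H} (hw : w ∈ D.radical) :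
        D.e k l b * w * (D.e k l b)⁻¹ ∈ D.radical := by
      refine hD.conj_mem_radical (fun i hi j hj u a ha => ?_) hw
      have h : i ≠ j := fun h => hj (h ▸ hi)
      obtain ⟨t, -, h₁, h₂⟩ := exists_mem_torusPow (R := R) (i := k) (j := l) h
        (fun h => hj (h.2 ▸ hS.mp (h.1 ▸ hi))) (fun h => hj (h.2 ▸ hS.mpr (h.1 ▸ hi))) u
      have h₃ := mul_inv_eq_iff_eq_mul.mpr (hD.mem_covariant hi hj t a)
      have h₄ := D.δ_e k l hkl hS t b
      rw [h₁, Units.val_one, one_mul] at h₄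
      have h₅ : Commute (D.δ t) (D.e k l b) := h₄
      have h₆ := hD.δ_conj_mem t (hD.conj_x_mem_radical (D.e_mem k l hb) ?_ hi hj ha)
      · rw [← h₂, ← h₃]
        have h₇ : (D.δ t)⁻¹ * (D.e k l b)⁻¹ = (D.e k l b)⁻¹ * (D.δ t)⁻¹ :=
          (h₅.inv_inv).eq
        simp only [← mul_assoc] at h₆ ⊢
        rwa [← h₅.eq, mul_assoc _ (D.δ t)⁻¹, h₇, ← mul_assoc]
      · rw [D.π_e _ _ hkl _ hS]
        exact Subgroup.subset_closure (.inr ⟨_, _, hkl, _, hS, rfl⟩)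
    have h₁ := mul_inv_eq_iff_eq_mul.mpr (D.δ_e k l hkl hS (torusElem k v) b)
    have h₂ := hD.δ_conj_mem (torusElem k v)
      (key (hD.δ_conj_mem (torusElem k v)⁻¹ hw))
    rw [torusWeight_torusElem_left hkl] at h₁
    rw [← h₁]
    simpa [mul_assoc] using h₂

theorem Relations.eq_one (hD : D.Relations) {g : H} (hg : π g = 1) : g = 1 := by
  let L : Subgroup H := Subgroup.closure
    (Set.range D.δ ∪ {h | ∃ i j r, i ≠ j ∧ (i ∈ S ↔ j ∈ S) ∧ h = D.e i j r})
  have hL : L ≤ Subgroup.normalizer (D.radical : Set H) := by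
    have key {y : H} (h₁ : ∀ w ∈ D.radical, y * w * y⁻¹ ∈ D.radical)
        (h₂ : ∀ w ∈ D.radical, y⁻¹ * w * y ∈ D.radical) :
        y ∈ Subgroup.normalizer (D.radical : Set H) :=
      Subgroup.mem_normalizer_iff.mpr fun w => ⟨h₁ w, fun h => by simpa [mul_assoc] using h₂ _ h⟩
    refine (Subgroup.closure_le _).mpr ?_
    rintro _ (⟨t, rfl⟩ | ⟨i, j, r, hij, hS, rfl⟩)
    · refine key (fun w => hD.δ_conj_mem t) fun w hw => ?_
      simpa using hD.δ_conj_mem t⁻¹ hw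
    · refine key (fun w => hD.e_conj_mem hij hS r) fun w hw => ?_
      have h : (D.e i j r)⁻¹ = D.e i j (-r) :=
        inv_eq_of_mul_eq_one_right (by rw [← D.e_add _ _ hij hS, add_neg_cancel, D.e_zero hij hS])
      have h' := hD.e_conj_mem hij hS (-r) hw
      rwa [← h, inv_inv] at h'
  have hξ (i j : Fin n) : D.ξ i j ∈ D.radical := by
    have h := hD.conj_mem 1 D.one_mem _ (D.ξ_mem i j)
    simp only [one_mul, inv_one, mul_one] at h
    refine h ?_
    by_cases hij : i ∈ S ∧ j ∉ S
    · have hne : i ≠ j := fun h => hij.2 (h ▸ hij.1)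
      rw [D.π_ξ _ _ hne hij]
      exact elemMat_mem_unipotentRadical hne hij.1 hij.2 1
    · rw [D.π_ξ_of_not _ _ hij]
      exact Subgroup.one_mem _
  have htop : L ⊔ D.radical = ⊤ := by
    refine top_le_iff.mp (D.generate.symm.trans_le ?_)
    rw [Subgroup.closure_union]
    refine sup_le_sup_left ((Subgroup.closure_le _).mpr ?_) _
    rintro _ ⟨i, j, rfl⟩
    exact hξ i j
  have hg' : g ∈ ((L ⊔ D.radical : Subgroup H) : Set H) := htop ▸ Subgroup.mem_top g
  rw [Subgroup.coe_mul_of_left_le_normalizer_right _ _ hL] at hg'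
  obtain ⟨l, hl, w, hw, rfl⟩ := hg'
  have hπl : π l ∈ blockLevi S R := by
    suffices L ≤ (blockLevi S R).comap π from this hl
    refine (Subgroup.closure_le _).mpr ?_
    rintro _ (⟨t, rfl⟩ | ⟨i, j, r, hij, hS, rfl⟩)
    · rw [SetLike.mem_coe, Subgroup.mem_comap, D.π_δ]
      exact torusHom_mem_blockLevi t
    · rw [SetLike.mem_coe, Subgroup.mem_comap, D.π_e _ _ hij r hS]
      exact Subgroup.subset_closure (.inr ⟨_, _, hij, _, hS, rfl⟩)
  have hπw : π w ∈ unipotentRadical S R := hD.radical_aux.2 ▸ Subgroup.mem_map_of_mem π hw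
  dsimp only at hg
  rw [map_mul] at hg
  have hl1 : l = 1 := by
    refine D.injective l hl (eq_one_of_mem_blockLevi_of_mem_unipotentRadical hπl ?_)
    rw [eq_inv_of_mul_eq_one_left hg]
    exact inv_mem hπw
  rw [hl1]
  refine (one_mul w).trans (hD.radical_aux.1 w hw ?_)
  rwa [hl1, map_one, one_mul] at hg

end ParabolicLift

end Lift

section Presentation

variable {n : ℕ} {S : Finset (Fin n)} {R : Type*} [CommRing R]

namespace ParabolicLift

variable {H : Type*} [Group H] {π : H →* Matrix.SpecialLinearGroup (Fin n) R} {A : Set R}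
  {T : Set (torus n R)} (D : ParabolicLift S π A T)

theorem finite_testSet (hA : A.Finite) (hT : T.Finite) : D.testSet.Finite := by
  have h₁ (f : Fin n → Fin n → R → H) : {h | ∃ i j, ∃ a ∈ A, h = f i j a}.Finite := by
    have : {h | ∃ i j, ∃ a ∈ A, h = f i j a} = ⋃ i, ⋃ j, f i j '' A := by
      ext
      simp [eq_comm]
    rw [this]
    exact Set.finite_iUnion fun _ => Set.finite_iUnion fun _ => hA.image _
  have h₂ : {h | ∃ i j, h = D.ξ i j}.Finite := by
    have : {h | ∃ i j, h = D.ξ i j} = ⋃ i, Set.range (D.ξ i) := by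
      ext
      simp [eq_comm]
    rw [this]
    exact Set.finite_iUnion fun _ => Set.finite_range _
  exact ((((hT.image _).union (h₁ _)).union h₂).union (h₁ _)).union (Set.finite_singleton 1)

theorem unipotentRadical_le_map_radical : unipotentRadical S R ≤ D.radical.map π := by
  refine unipotentRadical_le_closure.trans ((Subgroup.closure_le _).mpr ?_)
  rintro _ ⟨i, j, h, r, ⟨hi, hj⟩, rfl⟩
  exact ⟨_, D.x_mem_radical hi hj r, D.π_x h hi hj r⟩

/-- The image of a lift under a surjective homomorphism. -/
def map {H' : Type*} [Group H'] (q : H →* H') (hq : Function.Surjective q)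
    (π' : H' →* Matrix.SpecialLinearGroup (Fin n) R) (hπ : ∀ h, π' (q h) = π h) :
    ParabolicLift S π' A T where
  δ := q.comp D.δ
  e i j r := q (D.e i j r)
  ξ i j := q (D.ξ i j)
  m := D.m
  m_mem := D.m_mem
  m_ne := D.m_ne
  π_δ t := (hπ _).trans (D.π_δ t)
  π_e i j h r hS := (hπ _).trans (D.π_e i j h r hS)
  π_ξ i j h hS := (hπ _).trans (D.π_ξ i j h hS)
  π_ξ_of_not i j hS := (hπ _).trans (D.π_ξ_of_not i j hS)
  e_add i j h hS r s := by rw [D.e_add i j h hS, map_mul]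
  δ_e i j h hS t r := (D.δ_e i j h hS t r).map q
  generate := by
    rw [← top_le_iff, ← Subgroup.map_top_of_surjective q hq, ← D.generate, MonoidHom.map_closure]
    refine Subgroup.closure_mono ?_
    rintro _ ⟨_, (⟨t, rfl⟩ | ⟨i, j, r, h, hS, rfl⟩) | ⟨i, j, rfl⟩, rfl⟩
    · exact .inl (.inl ⟨t, rfl⟩)
    · exact .inl (.inr ⟨i, j, r, h, hS, rfl⟩)
    · exact .inr ⟨i, j, rfl⟩
  injective l hl hl' := by
    suffices l ∈ (Subgroup.closure (Set.range D.δ ∪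
        {h | ∃ i j r, i ≠ j ∧ (i ∈ S ↔ j ∈ S) ∧ h = D.e i j r})).map q by
      obtain ⟨l, hl₀, rfl⟩ := this
      rw [D.injective l hl₀ ((hπ l).symm.trans hl'), map_one]
    rw [MonoidHom.map_closure]
    refine Subgroup.closure_mono ?_ hl
    rintro _ (⟨t, rfl⟩ | ⟨i, j, r, h, hS, rfl⟩)
    · exact ⟨_, .inl ⟨t, rfl⟩, rfl⟩
    · exact ⟨_, .inr ⟨i, j, r, h, hS, rfl⟩, rfl⟩
  span := D.span
  ker_le := D.ker_le

section map

variable {H' : Type*} [Group H'] (q : H →* H') (hq : Function.Surjective q)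
    (π' : H' →* Matrix.SpecialLinearGroup (Fin n) R) (hπ : ∀ h, π' (q h) = π h)

theorem map_x (i j : Fin n) (r : R) : (D.map q hq π' hπ).x i j r = q (D.x i j r) :=
  (map_commutatorElement q _ _).symm

theorem testSet_map : (D.map q hq π' hπ).testSet ⊆ q '' D.testSet := by
  rintro _ ((((⟨t, ht, rfl⟩ | ⟨i, j, a, ha, rfl⟩) | ⟨i, j, rfl⟩) | ⟨i, j, a, ha, rfl⟩) | rfl)
  · exact ⟨_, D.δ_mem ht, rfl⟩
  · exact ⟨_, D.e_mem i j ha, rfl⟩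
  · exact ⟨_, D.ξ_mem i j, rfl⟩
  · exact ⟨_, D.x_mem i j ha, (D.map_x ..).symm⟩
  · exact ⟨_, D.one_mem, map_one q⟩

theorem map_radical_le : D.radical.map q ≤ (D.map q hq π' hπ).radical := by
  rw [Subgroup.map_le_iff_le_comap]
  refine (Subgroup.closure_le _).mpr ?_
  rintro _ ⟨i, j, r, hS, rfl⟩
  exact Subgroup.subset_closure ⟨i, j, r, hS, (D.map_x ..).symm⟩

end map

/-- The kernel of a lift is normally generated by relations between the elements of the
test set. -/
theorem isFinitelyNormallyGenerated_ker (D : ParabolicLift S π A T) (hA : A.Finite) (hT : T.Finite)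
    :
    π.ker.IsFinitelyNormallyGenerated := by
  have hw (g : H) : ∃ w ∈ D.radical, π g ∈ unipotentRadical S R → π w = π g := by
    by_cases hg : π g ∈ unipotentRadical S R
    · obtain ⟨w, hw, h⟩ := D.unipotentRadical_le_map_radical hg
      exact ⟨w, hw, fun _ => h⟩
    · exact ⟨1, Subgroup.one_mem _, fun h => (hg h).elim⟩
  choose w hw hπw using hw
  have hfin := D.finite_testSet hA hT
  let F : Set H := (Set.image2 (fun y z => ⁅y, z⁆) D.testSet D.testSet ∪
    Set.image2 (fun y z => y * z * y⁻¹ * (w (y * z * y⁻¹))⁻¹) D.testSet D.testSet) ∩ π.ker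
  have hF : Subgroup.normalClosure F ≤ π.ker :=
    Subgroup.normalClosure_le_normal Set.inter_subset_right
  refine ⟨F, ((hfin.image2 _ hfin).union (hfin.image2 _ hfin)).inter_of_left _, le_antisymm hF ?_⟩
  let q := QuotientGroup.mk' (Subgroup.normalClosure F)
  let D' := D.map q (QuotientGroup.mk'_surjective _) (QuotientGroup.lift _ π hF) fun _ => rfl
  have hq {g : H} (hg : g ∈ F) : q g = 1 :=
    (QuotientGroup.eq_one_iff g).mpr (Subgroup.subset_normalClosure hg)
  have hD' : D'.Relations := by
    constructor
    · intro y hy z hz h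
      obtain ⟨y, hy₀, rfl⟩ := D.testSet_map _ _ _ _ hy
      obtain ⟨z, hz₀, rfl⟩ := D.testSet_map _ _ _ _ hz
      rw [← commutatorElement_eq_one_iff_commute, ← map_commutatorElement] at h ⊢
      exact hq ⟨.inl ⟨y, hy₀, z, hz₀, rfl⟩, h⟩
    · intro y hy z hz h
      obtain ⟨y, hy₀, rfl⟩ := D.testSet_map _ _ _ _ hy
      obtain ⟨z, hz₀, rfl⟩ := D.testSet_map _ _ _ _ hz
      rw [← map_inv, ← map_mul, ← map_mul] at h ⊢
      have h' := hq (g := y * z * y⁻¹ * (w (y * z * y⁻¹))⁻¹) ⟨.inr ⟨y, hy₀, z, hz₀, rfl⟩, by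
        rw [SetLike.mem_coe, MonoidHom.mem_ker, map_mul, map_inv, hπw _ h, mul_inv_cancel]⟩
      rw [map_mul, map_inv, mul_inv_eq_one] at h'
      rw [h']
      exact D.map_radical_le _ _ _ _ (Subgroup.mem_map_of_mem q (hw _))
  intro g hg
  exact (QuotientGroup.eq_one_iff g).mp (hD'.eq_one (g := q g) hg)

end ParabolicLift

variable (S R) in
/-- The map from the free product of the Levi factor and a free group on the generators of the
unipotent radical. -/
def blockHom : Monoid.Coprod (blockLevi S R) (FreeGroup (Fin n × Fin n)) →*
    Matrix.SpecialLinearGroup (Fin n) R :=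
  Monoid.Coprod.lift (blockLevi S R).subtype <| FreeGroup.lift fun p =>
    if h : p.1 ∈ S ∧ p.2 ∉ S then elemMat p.1 p.2 (fun h' => h.2 (h' ▸ h.1)) 1 else 1

theorem elemMat_mem_blockLevi {i j : Fin n} (h : i ≠ j) (hS : i ∈ S ↔ j ∈ S) (r : R) :
    elemMat i j h r ∈ blockLevi S R :=
  Subgroup.subset_closure (.inr ⟨i, j, h, r, hS, rfl⟩)

open Classical in
/-- The tautological lift of the parabolic subgroup. -/
noncomputable def blockLift (hS : 1 < S.card) {A : Set R} {T : Set (torus n R)}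
    (span : AddSubmonoid.closure {r : R | ∃ u : Rˣ, ∃ a ∈ A, r = (u ^ n : Rˣ) * a} = ⊤)
    (ker_le : ∀ i j : Fin n,
      (torusWeight i j).ker ≤ Subgroup.closure {t : torus n R | t ∈ T ∧ torusWeight i j t = 1}) :
    ParabolicLift S (blockHom S R) A T where
  δ := Monoid.Coprod.inl.comp
    ((torusHom n R).codRestrict (blockLevi S R) ParabolicLift.torusHom_mem_blockLevi)
  e i j r := if h : i ≠ j ∧ (i ∈ S ↔ j ∈ S) then
    Monoid.Coprod.inl ⟨elemMat i j h.1 r, elemMat_mem_blockLevi h.1 h.2 r⟩ else 1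
  ξ i j := Monoid.Coprod.inr (FreeGroup.of (i, j))
  m i := (S.exists_mem_ne hS i).choose
  m_mem i := (S.exists_mem_ne hS i).choose_spec.1
  m_ne i := (S.exists_mem_ne hS i).choose_spec.2
  π_δ t := by simp [blockHom]
  π_e i j h r hS := by simp [blockHom, h, hS]
  π_ξ i j h hS := by simp [blockHom, hS]
  π_ξ_of_not i j hS := by
    rw [blockHom, Monoid.Coprod.lift_apply_inr, FreeGroup.lift_apply_of, dif_neg hS]
  e_add i j h hS r s := by
    simp only [dif_pos (And.intro h hS), ← map_mul]
    exact congrArg _ (Subtype.ext (elemMat_add i j h r s))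
  δ_e i j h hS t r := by
    simp only [dif_pos (And.intro h hS), MonoidHom.comp_apply]
    refine SemiconjBy.map ?_ Monoid.Coprod.inl
    exact Subtype.ext (torusHom_semiconj_elemMat h t r)
  generate := by
    rw [← top_le_iff, ← Monoid.Coprod.range_inl_sup_range_inr, sup_le_iff]
    constructor
    · have htop : Subgroup.closure ((↑) ⁻¹' (diagMats n R ∪ blockElems S R)) =
          (⊤ : Subgroup (blockLevi S R)) := Subgroup.closure_closure_coe_preimage
      rw [MonoidHom.range_eq_map, ← htop, MonoidHom.map_closure]
      refine Subgroup.closure_mono ?_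
      rintro _ ⟨⟨g, hg⟩, hg' | ⟨i, j, h, r, hS, rfl⟩, rfl⟩
      · rw [← range_torusHom] at hg'
        obtain ⟨t, rfl⟩ := hg'
        exact .inl (.inl ⟨t, rfl⟩)
      · refine .inl (.inr ⟨i, j, r, h, hS, ?_⟩)
        rw [dif_pos ⟨h, hS⟩]
    · rw [MonoidHom.range_eq_map, ← FreeGroup.closure_range_of, MonoidHom.map_closure]
      refine Subgroup.closure_mono ?_
      rintro _ ⟨_, ⟨p, rfl⟩, rfl⟩
      exact .inr ⟨p.1, p.2, rfl⟩
  injective l hl hl' := by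
    obtain ⟨l, rfl⟩ : l ∈ (Monoid.Coprod.inl : blockLevi S R →*
        Monoid.Coprod (blockLevi S R) (FreeGroup (Fin n × Fin n))).range := by
      refine (Subgroup.closure_le _).mpr ?_ hl
      rintro _ (⟨t, rfl⟩ | ⟨i, j, r, h, hS, rfl⟩)
      · exact ⟨_, rfl⟩
      · rw [dif_pos ⟨h, hS⟩]
        exact ⟨_, rfl⟩
    rw [blockHom, Monoid.Coprod.lift_apply_inl] at hl'
    rw [show l = 1 from Subtype.ext hl', map_one]
  span := span
  ker_le := ker_le

theorem range_blockHom_le : (blockHom S R).range ≤ blockParabolic S R := by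
  rw [MonoidHom.range_eq_map, ← Monoid.Coprod.range_inl_sup_range_inr, Subgroup.map_sup,
    sup_le_iff]
  constructor
  · rintro _ ⟨_, ⟨l, rfl⟩, rfl⟩
    rw [blockHom, Monoid.Coprod.lift_apply_inl]
    exact blockLevi_le_blockParabolic l.2
  · rw [MonoidHom.range_eq_map, ← FreeGroup.closure_range_of, Subgroup.map_map,
      MonoidHom.map_closure, Subgroup.closure_le]
    rintro _ ⟨_, ⟨p, rfl⟩, rfl⟩
    rw [MonoidHom.comp_apply, blockHom, Monoid.Coprod.lift_apply_inr, FreeGroup.lift_apply_of]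
    split_ifs with h
    · exact unipotentRadical_le_blockParabolic (elemMat_mem_unipotentRadical _ h.1 h.2 1)
    · exact Subgroup.one_mem _

theorem blockParabolic_isFinitelyPresented (hS : 1 < S.card) {A : Set R} {T : Set (torus n R)}
    (hA : A.Finite) (hT : T.Finite)
    (span : AddSubmonoid.closure {r : R | ∃ u : Rˣ, ∃ a ∈ A, r = (u ^ n : Rˣ) * a} = ⊤)
    (ker_le : ∀ i j : Fin n,
      (torusWeight i j).ker ≤ Subgroup.closure {t : torus n R | t ∈ T ∧ torusWeight i j t = 1})
    [Group.IsFinitelyPresented (blockLevi S R)] :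
    Group.IsFinitelyPresented (blockParabolic S R) := by
  let D := blockLift hS span ker_le
  have hrange : (blockHom S R).range = blockParabolic S R := by
    refine le_antisymm range_blockHom_le ?_
    rw [blockParabolic_eq_sup, sup_le_iff]
    refine ⟨fun l hl => ⟨Monoid.Coprod.inl ⟨l, hl⟩, by simp [blockHom]⟩, ?_⟩
    exact D.unipotentRadical_le_map_radical.trans (Subgroup.map_le_range _ _)
  rw [← hrange]
  refine Group.IsFinitelyPresented.of_surjective (blockHom S R).rangeRestrict
    (MonoidHom.rangeRestrict_surjective _) ?_
  rw [MonoidHom.ker_rangeRestrict]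
  exact D.isFinitelyNormallyGenerated_ker hA hT

/-- Finite presentability passes to the Levi factor: it is a retract of the parabolic subgroup whose
kernel is normally generated by a finite set. -/
theorem blockLevi_isFinitelyPresented [Group.IsFinitelyPresented (blockParabolic S R)] :
    Group.IsFinitelyPresented (blockLevi S R) := by
  let P := blockParabolic S R
  let U : Subgroup P := (unipotentRadical S R).subgroupOf P
  have hU : U.Normal := by
    rw [Subgroup.normal_subgroupOf_iff_le_normalizer unipotentRadical_le_blockParabolic]
    exact blockParabolic_eq_sup.trans_le (sup_le blockLevi_le_normalizer Subgroup.le_normalizer)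
  let φ : blockLevi S R →* P ⧸ U :=
    (QuotientGroup.mk' U).comp (Subgroup.inclusion blockLevi_le_blockParabolic)
  have hφ : Function.Injective φ := by
    rw [injective_iff_map_eq_one]
    intro l hl
    have hl' : (l : Matrix.SpecialLinearGroup (Fin n) R) ∈ unipotentRadical S R :=
      (QuotientGroup.eq_one_iff (N := U) _).mp hl
    exact Subtype.ext (eq_one_of_mem_blockLevi_of_mem_unipotentRadical l.2 hl')
  have hex (p : P) : ∃ l : blockLevi S R, ∃ u ∈ U,
      Subgroup.inclusion blockLevi_le_blockParabolic l * u = p := by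
    obtain ⟨l, hl, u, hu, h⟩ := exists_of_mem_blockParabolic p.2
    exact ⟨⟨l, hl⟩, ⟨u, unipotentRadical_le_blockParabolic hu⟩, hu, Subtype.ext h⟩
  have hφ' : Function.Surjective φ := by
    intro p
    obtain ⟨p, rfl⟩ := QuotientGroup.mk'_surjective U p
    obtain ⟨l, u, hu, rfl⟩ := hex p
    refine ⟨l, ?_⟩
    rw [map_mul, show QuotientGroup.mk' U u = 1 from (QuotientGroup.eq_one_iff u).mpr hu, mul_one]
    rfl
  choose l u hu hlu using hex
  obtain ⟨_, ψ, hψ, -⟩ := Group.IsFinitelyPresented.out (G := P)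
  obtain ⟨G, hG, hGfin⟩ := Group.fg_iff.mp (Group.fg_of_surjective hψ)
  have hUfin : U.IsFinitelyNormallyGenerated := by
    refine ⟨u '' G, hGfin.image _, le_antisymm ?_ ?_⟩
    · refine Subgroup.normalClosure_le_normal ?_
      rintro _ ⟨p, _, rfl⟩
      exact hu p
    · let N := Subgroup.normalClosure (u '' G)
      have htop : (Subgroup.inclusion (blockLevi_le_blockParabolic (S := S) (R := R))).range ⊔ N =
        ⊤ := by
        rw [← top_le_iff, ← hG, Subgroup.closure_le]
        intro p hp
        rw [← hlu p]
        exact mul_mem (Subgroup.mem_sup_left ⟨l p, rfl⟩)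
          (Subgroup.mem_sup_right (Subgroup.subset_normalClosure ⟨p, hp, rfl⟩))
      intro w hw
      have hw' : w ∈ (⊤ : Subgroup P) := trivial
      rw [← htop, ← SetLike.mem_coe, Subgroup.mul_normal] at hw'
      obtain ⟨_, ⟨k, rfl⟩, v, hv, rfl⟩ := hw'
      have hvU : v ∈ U := by
        refine Subgroup.normalClosure_le_normal ?_ hv
        rintro _ ⟨p, _, rfl⟩
        exact hu p
      have hk : k = 1 := Subtype.ext <|
        eq_one_of_mem_blockLevi_of_mem_unipotentRadical k.2
          ((Subgroup.mul_mem_cancel_right U hvU).mp hw)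
      rw [hk]
      simpa using hv
  have := Group.IsFinitelyPresented.quotient U hUfin
  exact .equiv (MulEquiv.ofBijective φ ⟨hφ, hφ'⟩).symm

end Presentation

section Complement

variable {n : ℕ} {R : Type*} [CommRing R] (S : Finset (Fin n))

/-- The inverse transpose automorphism of `SL_n(R)`. -/
def invTranspose (n : ℕ) (R : Type*) [CommRing R] :
    Matrix.SpecialLinearGroup (Fin n) R →* Matrix.SpecialLinearGroup (Fin n) R where
  toFun g := (g⁻¹).transpose
  map_one' := specialLinearGroup_ext (by simp)
  map_mul' g h := specialLinearGroup_ext (by simp)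

theorem invTranspose_elemMat {i j : Fin n} (h : i ≠ j) (r : R) :
    invTranspose n R (elemMat i j h r) = elemMat j i h.symm (-r) := by
  change ((elemMat i j h r)⁻¹).transpose = _
  rw [elemMat_inv]
  refine specialLinearGroup_ext ?_
  rw [Matrix.SpecialLinearGroup.coe_transpose, coe_elemMat, coe_elemMat, Matrix.transpose_add,
    Matrix.transpose_one, Matrix.transpose_single]

theorem invTranspose_invTranspose (g : Matrix.SpecialLinearGroup (Fin n) R) :
    invTranspose n R (invTranspose n R g) = g := by
  change (((g⁻¹).transpose)⁻¹).transpose = g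
  refine specialLinearGroup_ext ?_
  rw [Matrix.SpecialLinearGroup.coe_transpose, Matrix.SpecialLinearGroup.coe_inv,
    Matrix.SpecialLinearGroup.coe_transpose, ← Matrix.adjugate_transpose,
    Matrix.transpose_transpose,
    ← Matrix.SpecialLinearGroup.coe_inv, inv_inv]

theorem blockLevi_compl : blockLevi Sᶜ R = blockLevi S R := by
  simp [blockLevi, blockElems, not_iff_not]

theorem blockParabolic_le_comap :
    blockParabolic S R ≤ (blockParabolic Sᶜ R).comap (invTranspose n R) := by
  refine (Subgroup.closure_le _).mpr ?_
  rintro g ((hg | ⟨i, j, h, r, hij, rfl⟩) | ⟨i, j, h, r, hij, rfl⟩)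
  · refine Subgroup.subset_closure (.inl (.inl ?_))
    rw [← range_torusHom] at hg ⊢
    obtain ⟨t, rfl⟩ := hg
    refine ⟨t⁻¹, ?_⟩
    change _ = ((torusHom n R t)⁻¹).transpose
    rw [← map_inv]
    refine specialLinearGroup_ext ?_
    rw [Matrix.SpecialLinearGroup.coe_transpose, coe_torusHom, Matrix.diagonal_transpose]
  · rw [SetLike.mem_coe, Subgroup.mem_comap, invTranspose_elemMat]
    exact Subgroup.subset_closure (.inl (.inr ⟨_, _, h.symm, _, by simp [hij], rfl⟩))
  · rw [SetLike.mem_coe, Subgroup.mem_comap, invTranspose_elemMat]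
    exact Subgroup.subset_closure (.inr ⟨_, _, h.symm, _, by simp [hij], rfl⟩)

theorem map_blockParabolic : (blockParabolic S R).map (invTranspose n R) = blockParabolic Sᶜ R := by
  refine le_antisymm (Subgroup.map_le_iff_le_comap.mpr (blockParabolic_le_comap S)) fun g hg => ?_
  have h := blockParabolic_le_comap Sᶜ hg
  rw [compl_compl] at h
  exact ⟨_, h, invTranspose_invTranspose g⟩

/-- The parabolic subgroups attached to a set and to its complement are isomorphic. -/
noncomputable def blockParabolicEquiv (R : Type*) [CommRing R] :
    blockParabolic S R ≃* blockParabolic Sᶜ R :=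
  ((blockParabolic S R).equivMapOfInjective (invTranspose n R)
    (Function.LeftInverse.injective invTranspose_invTranspose)).trans
    (MulEquiv.subgroupCongr (map_blockParabolic S))

end Complement

section FinitelyPresented

theorem isFinitelyPresented_iff (G : Type*) [Group G] :
    IsFinitelyPresented G ↔ Group.IsFinitelyPresented G := by
  constructor
  · rintro ⟨m, F, ⟨e⟩⟩
    have := Group.IsFinitelyPresented.quotient
      (Subgroup.normalClosure (F : Set (FreeGroup (Fin m))))
      ⟨F, F.finite_toSet, rfl⟩
    exact .equiv e
  · intro h
    obtain ⟨m, F, hF, ⟨e⟩⟩ := Group.IsFinitelyPresented.exists_mulEquiv_presentedGroup (G := G)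
    lift F to Finset (FreeGroup (Fin m)) using hF
    exact ⟨m, F, ⟨e.symm⟩⟩

end FinitelyPresented

section Maximal

variable {n : ℕ} {R : Type*} [CommRing R]

/-- The indices of the first `k` coordinates. -/
def initialBlock (n k : ℕ) : Finset (Fin n) := {i | i.val < k}

theorem mem_initialBlock {k : ℕ} {i : Fin n} : i ∈ initialBlock n k ↔ i.val < k := by
  simp [initialBlock]

theorem iconn_iff {k : ℕ} {i j : Fin n} (hij : i < j) :
    IConn (Set.Icc 1 (n - 1) \ {k}) i j ↔ (i ∈ initialBlock n k ↔ j ∈ initialBlock n k) := by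
  simp only [mem_initialBlock, IConn, Set.mem_sdiff, Set.mem_Icc, Set.mem_singleton_iff]
  have hij' : i.val < j.val := hij
  have hj := j.isLt
  constructor
  · intro h
    by_contra h'
    exact (h k (by omega) (by omega)).2 rfl
  · intro h l h₁ h₂
    omega

theorem upperElems_union_lowerElems (k : ℕ) :
    upperElems n R (Set.Icc 1 (n - 1) \ {k}) ∪ lowerElems n R (Set.Icc 1 (n - 1) \ {k}) =
      blockElems (initialBlock n k) R := by
  ext g
  constructor
  · rintro (⟨i, j, h, r, hij, rfl⟩ | ⟨i, j, h, r, hij, rfl⟩)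
    · exact ⟨i, j, h.ne, r, (iconn_iff h).mp hij, rfl⟩
    · exact ⟨j, i, h.ne', r, ((iconn_iff h).mp hij).symm, rfl⟩
  · rintro ⟨i, j, h, r, hij, rfl⟩
    obtain h' | h' := h.lt_or_gt
    · exact .inl ⟨i, j, h', r, (iconn_iff h').mpr hij, rfl⟩
    · exact .inr ⟨j, i, h', r, (iconn_iff h').mpr hij.symm, rfl⟩

theorem allUpperElems_union_lowerElems (k : ℕ) :
    allUpperElems n R ∪ lowerElems n R (Set.Icc 1 (n - 1) \ {k}) =
      blockElems (initialBlock n k) R ∪ mixedElems (initialBlock n k) R := by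
  rw [← upperElems_union_lowerElems, Set.union_right_comm]
  congr 1
  ext g
  constructor
  · rintro ⟨i, j, h, r, rfl⟩
    by_cases hij : i ∈ initialBlock n k ↔ j ∈ initialBlock n k
    · exact .inl ⟨i, j, h, r, (iconn_iff h).mpr hij, rfl⟩
    · refine .inr ⟨i, j, h.ne, r, ?_, rfl⟩
      have : i.val < j.val := h
      simp only [mem_initialBlock] at hij ⊢
      omega
  · rintro (⟨i, j, h, r, -, rfl⟩ | ⟨i, j, h, r, ⟨hi, hj⟩, rfl⟩)
    · exact ⟨i, j, h, r, rfl⟩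
    · rw [mem_initialBlock] at hi hj
      exact ⟨i, j, Fin.lt_def.mpr (by omega), r, rfl⟩

theorem levi_eq_blockLevi (k : ℕ) :
    levi n R (Set.Icc 1 (n - 1) \ {k}) = blockLevi (initialBlock n k) R := by
  rw [levi, blockLevi, Set.union_assoc, upperElems_union_lowerElems]

theorem parabolic_eq_blockParabolic (k : ℕ) :
    parabolic n R (Set.Icc 1 (n - 1) \ {k}) = blockParabolic (initialBlock n k) R := by
  rw [parabolic, blockParabolic, Set.union_assoc, allUpperElems_union_lowerElems, Set.union_assoc]

end Maximal

section UpperTriangular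

variable {n : ℕ} {R : Type*} [CommRing R]

/-- The upper triangular matrices in `SL_n(R)`. -/
def upperTriangular (n : ℕ) (R : Type*) [CommRing R] : Subgroup
    (Matrix.SpecialLinearGroup (Fin n) R) where
  carrier := {g | (g : Matrix (Fin n) (Fin n) R).BlockTriangular id ∧
    ((g⁻¹ : Matrix.SpecialLinearGroup (Fin n) R) : Matrix (Fin n) (Fin n) R).BlockTriangular id}
  one_mem' := by
    simp only [Set.mem_ofPred_eq, inv_one, Matrix.SpecialLinearGroup.coe_one, and_self]
    exact Matrix.blockTriangular_one
  mul_mem' {g h} hg hh := by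
    simp only [Set.mem_ofPred_eq, mul_inv_rev]
    exact ⟨hg.1.mul hh.1, hh.2.mul hg.2⟩
  inv_mem' {g} hg := by
    simp only [Set.mem_ofPred_eq, inv_inv]
    exact hg.symm

theorem apply_eq_zero_of_mem_upperTriangular {g : Matrix.SpecialLinearGroup (Fin n) R}
    (hg : g ∈ upperTriangular n R)
    {i j : Fin n} (h : j < i) : (g : Matrix (Fin n) (Fin n) R) i j = 0 :=
  hg.1 h

theorem mul_apply_self_of_mem_upperTriangular {g h : Matrix.SpecialLinearGroup (Fin n) R}
    (hg : g ∈ upperTriangular n R) (hh : h ∈ upperTriangular n R) (i : Fin n) :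
    ((g * h : Matrix.SpecialLinearGroup (Fin n) R) : Matrix (Fin n) (Fin n) R) i i =
      (g : Matrix (Fin n) (Fin n) R) i i * (h : Matrix (Fin n) (Fin n) R) i i := by
  rw [Matrix.SpecialLinearGroup.coe_mul, Matrix.mul_apply]
  refine Finset.sum_eq_single i (fun j _ hj => ?_) fun h => (h (Finset.mem_univ i)).elim
  obtain hj | hj := hj.lt_or_gt
  · rw [apply_eq_zero_of_mem_upperTriangular hg hj, zero_mul]
  · rw [apply_eq_zero_of_mem_upperTriangular hh hj, mul_zero]

/-- The diagonal entries of an upper triangular matrix, as units. -/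
def diagEntry (i : Fin n) : upperTriangular n R →* Rˣ where
  toFun g :=
    { val := (g.1 : Matrix (Fin n) (Fin n) R) i i
      inv := ((g⁻¹).1 : Matrix (Fin n) (Fin n) R) i i
      val_inv := by
        rw [← mul_apply_self_of_mem_upperTriangular g.2 (g⁻¹).2, ← Subgroup.coe_mul, mul_inv_cancel]
        simp
      inv_val := by
        rw [← mul_apply_self_of_mem_upperTriangular (g⁻¹).2 g.2, ← Subgroup.coe_mul, inv_mul_cancel]
        simp }
  map_one' := Units.ext (by simp)
  map_mul' g h := Units.ext (mul_apply_self_of_mem_upperTriangular g.2 h.2 i)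

theorem coe_diagEntry (i : Fin n) (g : upperTriangular n R) :
    (diagEntry i g : R) = (g.1 : Matrix (Fin n) (Fin n) R) i i := rfl

theorem torusHom_mem_upperTriangular (t : torus n R) : torusHom n R t ∈ upperTriangular n R := by
  refine ⟨Matrix.blockTriangular_diagonal _, ?_⟩
  rw [← map_inv]
  exact Matrix.blockTriangular_diagonal _

theorem elemMat_mem_upperTriangular {i j : Fin n} (h : i < j) (r : R) : elemMat i j h.ne r ∈
    upperTriangular n R := by
  refine ⟨Matrix.blockTriangular_transvection h.le r, ?_⟩
  rw [elemMat_inv]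
  exact Matrix.blockTriangular_transvection h.le _

theorem parabolic_empty_le_upperTriangular : parabolic n R ∅ ≤ upperTriangular n R := by
  refine (Subgroup.closure_le _).mpr ?_
  rintro _ ((hg | ⟨i, j, h, r, rfl⟩) | ⟨i, j, h, r, hij, rfl⟩)
  · rw [← range_torusHom] at hg
    obtain ⟨t, rfl⟩ := hg
    exact torusHom_mem_upperTriangular t
  · exact elemMat_mem_upperTriangular h r
  · exact (hij j (Nat.succ_le_of_lt h) le_rfl).elim

theorem units_fg (hn : 2 ≤ n) (hB : Group.FG (parabolic n R ∅)) : Group.FG Rˣ := by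
  let i : Fin n := ⟨0, by omega⟩
  let j : Fin n := ⟨1, by omega⟩
  have hij : i ≠ j := by simp [i, j]
  refine Group.fg_of_surjective (f := (diagEntry i).comp
    (Subgroup.inclusion (parabolic_empty_le_upperTriangular (n := n) (R := R)))) fun u => ?_
  let t : torus n R := ⟨Pi.mulSingle i u * Pi.mulSingle j u⁻¹, by
    simp [torus, Finset.prod_mul_distrib]⟩
  refine ⟨⟨torusHom n R t, Subgroup.subset_closure (.inl (.inl ?_))⟩, Units.ext ?_⟩
  · rw [← range_torusHom]
    exact ⟨t, rfl⟩
  · simp [coe_diagEntry, coe_torusHom, t, hij]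

theorem mul_apply_zero_one (hn : 2 ≤ n) (g h : upperTriangular n R) :
    (g * h).1 ⟨0, by omega⟩ ⟨1, by omega⟩ =
      diagEntry ⟨0, by omega⟩ g * h.1 ⟨0, by omega⟩ ⟨1, by omega⟩ +
        g.1 ⟨0, by omega⟩ ⟨1, by omega⟩ * diagEntry ⟨1, by omega⟩ h := by
  rw [Subgroup.coe_mul, Matrix.SpecialLinearGroup.coe_mul, Matrix.mul_apply]
  refine Finset.sum_eq_add (⟨0, by omega⟩ : Fin n) ⟨1, by omega⟩ (by simp) (fun c _ hc => ?_)
    (fun h => (h (Finset.mem_univ _)).elim) (fun h => (h (Finset.mem_univ _)).elim)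
  have hc' : (⟨1, by omega⟩ : Fin n) < c := by
    simp only [ne_eq, Fin.ext_iff, Fin.lt_def] at hc ⊢
    omega
  rw [apply_eq_zero_of_mem_upperTriangular h.2 hc', mul_zero]

theorem exists_finite_span_units (hn : 2 ≤ n) (hB : Group.FG (parabolic n R ∅)) :
    ∃ A : Set R, A.Finite ∧ AddSubgroup.closure {r : R | ∃ u : Rˣ, ∃ a ∈ A, r = u * a} = ⊤ := by
  obtain ⟨X, hX, hfin⟩ := (Group.fg_iff (G := parabolic n R ∅)).mp hB
  let ε (g : upperTriangular n R) : R := g.1 ⟨0, by omega⟩ ⟨1, by omega⟩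
  let φ := Subgroup.inclusion (parabolic_empty_le_upperTriangular (n := n) (R := R))
  let A : Set R := (fun g => ε (φ g)) '' X
  refine ⟨A, hfin.image _, ?_⟩
  let M := AddSubgroup.closure {r : R | ∃ u : Rˣ, ∃ a ∈ A, r = u * a}
  change M = ⊤
  have hM (u : Rˣ) {r : R} (hr : r ∈ M) : u * r ∈ M := by
    induction hr using AddSubgroup.closure_induction with
    | mem r hr =>
      obtain ⟨v, a, ha, rfl⟩ := hr
      exact AddSubgroup.subset_closure ⟨u * v, a, ha, by rw [Units.val_mul, mul_assoc]⟩
    | zero => simp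
    | add r s _ _ hr hs => rw [mul_add]; exact add_mem hr hs
    | neg r _ hr => rw [mul_neg]; exact neg_mem hr
  have key (g : parabolic n R ∅) : ε (φ g) ∈ M := by
    have hg : g ∈ Subgroup.closure X := hX ▸ Subgroup.mem_top g
    induction hg using Subgroup.closure_induction with
    | mem g hg => exact AddSubgroup.subset_closure ⟨1, _, ⟨g, hg, rfl⟩, by simp⟩
    | one => simp [ε]
    | mul g h _ _ hg hh =>
      simp only [ε, map_mul, mul_apply_zero_one hn]
      rw [mul_comm ((φ g).1 _ _)]
      exact add_mem (hM _ hh) (hM _ hg)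
    | inv g _ hg =>
      have := mul_apply_zero_one hn (φ g) (φ g)⁻¹
      rw [mul_inv_cancel, Subgroup.coe_one, Matrix.SpecialLinearGroup.coe_one,
        Matrix.one_apply_ne (by simp), eq_comm, add_eq_zero_iff_eq_neg, mul_comm ((φ g).1 _ _),
        ← Units.eq_inv_mul_iff_mul_eq] at this
      simp only [ε, map_inv]
      rw [this]
      exact hM _ (neg_mem (hM _ hg))
  refine top_le_iff.mp fun r _ => ?_
  let e : parabolic n R ∅ := ⟨elemMat (⟨0, by omega⟩ : Fin n) ⟨1, by omega⟩ (by simp) r,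
    Subgroup.subset_closure (.inl (.inr ⟨_, _, by simp, r, rfl⟩))⟩
  have := key e
  simpa [ε, φ, e, elemMat, Matrix.transvection] using this

theorem finite_quotient_powers {G : Type*} [CommGroup G] [Group.FG G] {m : ℕ} (hm : m ≠ 0) :
    ∃ C : Set G, C.Finite ∧ ∀ g, ∃ c ∈ C, ∃ v, g = v ^ m * c := by
  let P := (powMonoidHom m : G →* G).range
  have htor : IsMulTorsion (G ⧸ P) := by
    intro g
    induction g using QuotientGroup.induction_on with
    | H g =>
      refine isOfFinOrder_iff_pow_eq_one.mpr ⟨m, Nat.pos_of_ne_zero hm, ?_⟩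
      rw [← QuotientGroup.mk_pow]
      exact (QuotientGroup.eq_one_iff _).mpr ⟨g, rfl⟩
  have := CommGroup.finite_of_fg_isMulTorsion (G ⧸ P) htor
  refine ⟨Set.range (Quotient.out : G ⧸ P → G), Set.finite_range _, fun g =>
    ⟨_, ⟨(g : G ⧸ P), rfl⟩, ?_⟩⟩
  obtain ⟨⟨_, v, rfl⟩, hv⟩ := QuotientGroup.mk_out_eq_mul P g
  refine ⟨v⁻¹, ?_⟩
  rw [hv]
  simp [mul_comm]

theorem exists_finite_span_powers (hn : 2 ≤ n) (hB : Group.FG (parabolic n R ∅)) :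
    ∃ A : Set R, A.Finite ∧
      AddSubmonoid.closure {r : R | ∃ u : Rˣ, ∃ a ∈ A, r = (u ^ n : Rˣ) * a} = ⊤ := by
  have := units_fg hn hB
  obtain ⟨A, hA, hspan⟩ := exists_finite_span_units hn hB
  obtain ⟨C, hC, hpow⟩ := finite_quotient_powers (G := Rˣ) (m := n) (by omega)
  let A' : Set R := Set.image2 (fun c a => (c : Rˣ) * a) C A
  refine ⟨A' ∪ -A', (hC.image2 _ hA).union (hC.image2 _ hA).neg, top_le_iff.mp ?_⟩
  rw [← AddSubgroup.top_toAddSubmonoid, ← hspan, AddSubgroup.closure_toAddSubmonoid]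
  refine AddSubmonoid.closure_mono ?_
  have key {r : R} (hr : ∃ u : Rˣ, ∃ a ∈ A, r = u * a) :
      ∃ v : Rˣ, ∃ a ∈ A', r = (v ^ n : Rˣ) * a := by
    obtain ⟨u, a, ha, rfl⟩ := hr
    obtain ⟨c, hc, v, rfl⟩ := hpow u
    exact ⟨v, _, ⟨c, hc, a, ha, rfl⟩, by rw [Units.val_mul, mul_assoc]⟩
  rintro r (hr | hr)
  · obtain ⟨v, a, ha, h⟩ := key hr
    exact ⟨v, a, .inl ha, h⟩
  · obtain ⟨v, a, ha, h⟩ := key hr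
    exact ⟨v, -a, .inr (by simpa using ha), by rw [mul_neg, ← h, neg_neg]⟩

theorem subgroup_fg_of_commGroup_fg {G : Type*} [CommGroup G] [Group.FG G] (K : Subgroup G) :
    K.FG := by
  rw [Subgroup.fg_iff_add_fg]
  have : Module.Finite ℤ (Additive G) := Module.Finite.iff_addGroup_fg.mpr inferInstance
  have := IsNoetherian.noetherian (AddSubgroup.toIntSubmodule (Subgroup.toAddSubgroup K))
  rw [Submodule.fg_iff_addSubgroup_fg] at this
  simpa using this

theorem exists_finite_ker_torusWeight_le (hn : 2 ≤ n) (hB : Group.FG (parabolic n R ∅)) :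
    ∃ T : Set (torus n R), T.Finite ∧ ∀ i j : Fin n,
      (torusWeight i j).ker ≤ Subgroup.closure {t : torus n R | t ∈ T ∧ torusWeight i j t = 1} := by
  have := units_fg hn hB
  have : Group.FG (torus n R) :=
    (Group.fg_iff_subgroup_fg _).mpr (subgroup_fg_of_commGroup_fg (torus n R))
  have h (i j : Fin n) := (Subgroup.fg_iff _).mp
    (subgroup_fg_of_commGroup_fg (torusWeight (R := R) i j).ker)
  choose T hT hfin using h
  refine ⟨⋃ i, ⋃ j, T i j, Set.finite_iUnion fun _ => Set.finite_iUnion fun _ => hfin _ _,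
    fun i j => ?_⟩
  conv_lhs => rw [← hT]
  refine Subgroup.closure_mono fun t ht => ⟨Set.mem_iUnion.mpr ⟨i, Set.mem_iUnion.mpr ⟨j, ht⟩⟩, ?_⟩
  exact MonoidHom.mem_ker.mp (hT i j ▸ Subgroup.subset_closure ht)

end UpperTriangular

/-- Maximal parabolics in type A_{n-1}: if all standard parabolic subgroups of SL_n(R)
(n ≥ 3) are finitely generated and I = {1,…,n−1} \ {k}, then the maximal parabolic
P_I(R) is finitely presented iff its Levi factor L_I(R) is finitely presented. -/
theorem maximalParabolic_finitelyPresented_iff_levi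
    {R : Type*} [CommRing R] {n : ℕ} (hn : 3 ≤ n)
    (hfg : ∀ J : Set ℕ, J ⊆ Set.Icc 1 (n - 1) → Group.FG ↥(parabolic n R J))
    (k : ℕ) (hk : k ∈ Set.Icc 1 (n - 1)) :
    IsFinitelyPresented ↥(parabolic n R (Set.Icc 1 (n - 1) \ {k})) ↔
      IsFinitelyPresented ↥(levi n R (Set.Icc 1 (n - 1) \ {k})) := by
  have hB : Group.FG (parabolic n R ∅) := hfg ∅ (Set.empty_subset _)
  obtain ⟨A, hA, hspan⟩ := exists_finite_span_powers (by omega) hB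
  obtain ⟨T, hT, hker⟩ := exists_finite_ker_torusWeight_le (by omega) hB
  rw [isFinitelyPresented_iff, isFinitelyPresented_iff, parabolic_eq_blockParabolic,
    levi_eq_blockLevi]
  refine ⟨fun _ => blockLevi_isFinitelyPresented, fun hL => ?_⟩
  by_cases hS : 1 < (initialBlock n k).card
  · exact blockParabolic_isFinitelyPresented hS hA hT hspan hker
  · have hS' : 1 < (initialBlock n k)ᶜ.card := by
      rw [Finset.card_compl, Fintype.card_fin]
      omega
    rw [← blockLevi_compl] at hL
    have := blockParabolic_isFinitelyPresented hS' hA hT hspan hker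
    exact .equiv (blockParabolicEquiv (initialBlock n k) R).symm
end

section
/- Let A = ℤ[t,t⁻¹] and let P₂ ≤ GL₁₂(A) be the subgroup of all invertible 12×12 matrices g over A such that g_{ij} = 0 whenever i > j, except that entries with both i, j ∈ {1,…,5} or both i, j ∈ {8,…,12} are unrestricted (i.e., P₂ is the block upper triangular subgroup with diagonal blocks of sizes 5, 1, 1, 5). Then P₂ is not finitely presented. -/
open scoped LaurentPolynomial commutatorElement

theorem commutatorElement_mul_center {H : Type*} [Group H] (a b : H) {y z : H}
    (hy : y ∈ Subgroup.center H) (hz : z ∈ Subgroup.center H) :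
    ⁅a * y, b * z⁆ = ⁅a, b⁆ := by
  rw [Subgroup.mem_center_iff] at hy hz
  have h : a * y * (b * z) = a * b * (y * z) := by
    rw [mul_assoc, ← mul_assoc y, ← hy b]; group
  have h' : b * z * (a * y) = b * a * (y * z) := by
    rw [mul_assoc, ← mul_assoc z, ← hz a, mul_assoc a, ← hy z]; group
  rw [commutatorElement_def, commutatorElement_def]
  calc a * y * (b * z) * (a * y)⁻¹ * (b * z)⁻¹
      = (a * y * (b * z)) * (b * z * (a * y))⁻¹ := by group
    _ = a * b * a⁻¹ * b⁻¹ := by rw [h, h']; group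

/-- If a finitely presented group maps to a group `H` by a map that is multiplicative up to a
central subgroup `Z`, then the commutators of the images of commuting elements all lie in one
finitely generated subgroup of `Z`. -/
theorem IsFinitelyPresented.exists_finset_commutator_mem_closure {P H : Type*} [Group P] [Group H]
    (hP : IsFinitelyPresented P) (Z : Subgroup H) (hZ : Z ≤ Subgroup.center H) (σ : P → H)
    (hσ : ∀ g h, (σ (g * h))⁻¹ * (σ g * σ h) ∈ Z) :
    ∃ S : Finset H, (S : Set H) ⊆ Z ∧
      ∀ g h, Commute g h → ⁅σ g, σ h⁆ ∈ Subgroup.closure (S : Set H) := by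
  classical
  obtain ⟨n, R, ⟨e⟩⟩ := hP
  have normal_of_le {K : Subgroup H} (hK : K ≤ Subgroup.center H) : K.Normal :=
    ⟨fun x hx g => by rwa [Subgroup.mem_center_iff.1 (hK hx) g, mul_inv_cancel_right]⟩
  have := normal_of_le hZ
  let ψ : P →* H ⧸ Z := MonoidHom.mk' (fun g => (σ g : H ⧸ Z)) fun g h => by
    rw [← QuotientGroup.mk_mul, QuotientGroup.eq]; exact hσ g h
  let φ : FreeGroup (Fin n) →* P := e.toMonoidHom.comp (QuotientGroup.mk' _)
  have hφ : Function.Surjective φ := e.surjective.comp (QuotientGroup.mk'_surjective _)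
  have hker (w) : φ w = 1 ↔ w ∈ Subgroup.normalClosure (R : Set (FreeGroup (Fin n))) := by
    change e (QuotientGroup.mk w) = 1 ↔ _
    rw [map_eq_one_iff e e.injective, QuotientGroup.eq_one_iff]
  let f : FreeGroup (Fin n) →* H := FreeGroup.lift fun i => σ (φ (FreeGroup.of i))
  have hf : (QuotientGroup.mk' Z).comp f = ψ.comp φ := by
    ext i; simp [f, ψ]
  have hfσ (w) : ∃ z ∈ Z, f w = σ (φ w) * z := by
    have h := DFunLike.congr_fun hf w
    exact ⟨(σ (φ w))⁻¹ * f w, QuotientGroup.eq.1 h.symm, by group⟩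
  have hS : ((R.image f : Finset H) : Set H) ⊆ Z := by
    intro x hx
    obtain ⟨w, hw, rfl⟩ := Finset.mem_image.1 (Finset.mem_coe.1 hx)
    have h := DFunLike.congr_fun hf w
    rw [MonoidHom.comp_apply, MonoidHom.comp_apply,
      (hker w).2 (Subgroup.subset_normalClosure hw), map_one] at h
    exact (QuotientGroup.eq_one_iff _).1 h
  refine ⟨R.image f, hS, fun g h hgh => ?_⟩
  have hnormal := normal_of_le (((Subgroup.closure_le Z).2 hS).trans hZ)
  have hle : Subgroup.normalClosure (R : Set (FreeGroup (Fin n))) ≤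
      (Subgroup.closure ((R.image f : Finset H) : Set H)).comap f :=
    Subgroup.normalClosure_le_normal fun w hw =>
      Subgroup.subset_closure (Finset.mem_coe.2 (Finset.mem_image_of_mem f hw))
  obtain ⟨w, rfl⟩ := hφ g
  obtain ⟨v, rfl⟩ := hφ h
  obtain ⟨y, hy, hfw⟩ := hfσ w
  obtain ⟨z, hz, hfv⟩ := hfσ v
  have hmem : f ⁅w, v⁆ ∈ Subgroup.closure ((R.image f : Finset H) : Set H) :=
    hle ((hker _).1 (by rwa [map_commutatorElement, commutatorElement_eq_one_iff_commute]))
  rwa [map_commutatorElement, hfw, hfv, commutatorElement_mul_center _ _ (hZ hy) (hZ hz)] at hmem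

namespace LaurentPolynomial

theorem invert_mul_self_of_unit (u : ℤ[T;T⁻¹]ˣ) : invert (u : ℤ[T;T⁻¹]) * u = 1 := by
  obtain ⟨n, p, hp⟩ := exists_T_pow (u : ℤ[T;T⁻¹])
  obtain ⟨m, q, hq⟩ := exists_T_pow ((u⁻¹ : ℤ[T;T⁻¹]ˣ) : ℤ[T;T⁻¹])
  have hpq : p * q = Polynomial.X ^ (n + m) := by
    apply Polynomial.toLaurent_injective
    rw [map_mul, hp, hq, Polynomial.toLaurent_X_pow, Nat.cast_add, T_add]
    linear_combination (T n * T m : ℤ[T;T⁻¹]) * u.mul_inv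
  obtain ⟨i, -, w, hw⟩ := (dvd_prime_pow Polynomial.prime_X _).1 (Dvd.intro _ hpq)
  obtain ⟨r, hr, hrw⟩ := Polynomial.isUnit_iff.1 w.isUnit
  have hrr : (C r : ℤ[T;T⁻¹]) * C r = 1 := by
    rw [← map_mul, Int.isUnit_mul_self hr, map_one]
  have hu : (u : ℤ[T;T⁻¹]) * T n * C r = T i := by
    rw [← hp, ← Polynomial.toLaurent_C, hrw, ← map_mul, hw, Polynomial.toLaurent_X_pow]
  have hu' := congrArg invert hu
  simp only [map_mul, invert_T, invert_C] at hu'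
  have hT (k : ℤ) : (T (-k) : ℤ[T;T⁻¹]) * T k = 1 := by rw [← T_add, neg_add_cancel, T_zero]
  calc invert (u : ℤ[T;T⁻¹]) * (u : ℤ[T;T⁻¹])
      = (invert (u : ℤ[T;T⁻¹]) * T (-n) * C r) * ((u : ℤ[T;T⁻¹]) * T n * C r) := by
        linear_combination (-invert (u : ℤ[T;T⁻¹]) * (u : ℤ[T;T⁻¹]) * (C r * C r)) * hT n
          - (invert (u : ℤ[T;T⁻¹]) * (u : ℤ[T;T⁻¹])) * hrr
    _ = 1 := by rw [hu', hu, hT]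

end LaurentPolynomial

open LaurentPolynomial

/-- The central extension by `ℤ[T;T⁻¹]` of the affine group `ℤ[T;T⁻¹] ⋊ ℤ[T;T⁻¹]ˣ` with cocycle
`((x, u), (y, v)) ↦ invert x * u * y`. -/
@[ext]
structure AffineCentralExtension where
  translation : ℤ[T;T⁻¹]
  scale : ℤ[T;T⁻¹]ˣ
  central : ℤ[T;T⁻¹]

namespace AffineCentralExtension

noncomputable instance : Mul AffineCentralExtension where
  mul a b := ⟨a.translation + a.scale * b.translation, a.scale * b.scale,
    a.central + b.central + invert a.translation * a.scale * b.translation⟩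

noncomputable instance : One AffineCentralExtension := ⟨⟨0, 1, 0⟩⟩

noncomputable instance : Inv AffineCentralExtension where
  inv a := ⟨-(↑a.scale⁻¹ * a.translation), a.scale⁻¹,
    invert a.translation * a.translation - a.central⟩

@[simp] theorem translation_mul (a b : AffineCentralExtension) :
    (a * b).translation = a.translation + a.scale * b.translation := rfl

@[simp] theorem scale_mul (a b : AffineCentralExtension) :
    (a * b).scale = a.scale * b.scale := rfl

@[simp] theorem central_mul (a b : AffineCentralExtension) :
    (a * b).central =
      a.central + b.central + invert a.translation * a.scale * b.translation := rfl

@[simp] theorem translation_one : (1 : AffineCentralExtension).translation = 0 := rfl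

@[simp] theorem scale_one : (1 : AffineCentralExtension).scale = 1 := rfl

@[simp] theorem central_one : (1 : AffineCentralExtension).central = 0 := rfl

@[simp] theorem translation_inv (a : AffineCentralExtension) :
    a⁻¹.translation = -(↑a.scale⁻¹ * a.translation) := rfl

@[simp] theorem scale_inv (a : AffineCentralExtension) : a⁻¹.scale = a.scale⁻¹ := rfl

@[simp] theorem central_inv (a : AffineCentralExtension) :
    a⁻¹.central = invert a.translation * a.translation - a.central := rfl

noncomputable instance : Group AffineCentralExtension :=
  Group.ofLeftAxioms
    (fun a b c => by
      ext1
      · simp only [translation_mul, scale_mul, Units.val_mul]; ring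
      · simp only [scale_mul, mul_assoc]
      · simp only [central_mul, translation_mul, scale_mul, Units.val_mul, map_add, map_mul]
        linear_combination (invert b.translation * b.scale * c.translation) *
          invert_mul_self_of_unit a.scale)
    (fun a => by ext1 <;> simp)
    (fun a => by
      ext1
      · simp
      · simp
      · simp only [central_mul, central_inv, central_one, translation_inv, scale_inv, map_neg,
          map_mul]
        linear_combination (-invert a.translation * a.translation) *
          invert_mul_self_of_unit a.scale⁻¹)

/-- The elements of the central kernel whose central component takes values in `C`. -/
def centralSubgroup (C : AddSubgroup ℤ[T;T⁻¹]) : Subgroup AffineCentralExtension where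
  carrier := {a | a.translation = 0 ∧ a.scale = 1 ∧ a.central ∈ C}
  mul_mem' := by
    rintro a b ⟨ha, ha', ha''⟩ ⟨hb, hb', hb''⟩
    simpa [ha, ha', hb, hb'] using C.add_mem ha'' hb''
  one_mem' := by simp [C.zero_mem]
  inv_mem' := by
    rintro a ⟨ha, ha', ha''⟩
    simpa [ha, ha'] using ha''

theorem mem_centralSubgroup {C : AddSubgroup ℤ[T;T⁻¹]} {a : AffineCentralExtension} :
    a ∈ centralSubgroup C ↔ a.translation = 0 ∧ a.scale = 1 ∧ a.central ∈ C := Iff.rfl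

theorem centralSubgroup_le_center (C : AddSubgroup ℤ[T;T⁻¹]) :
    centralSubgroup C ≤ Subgroup.center AffineCentralExtension := by
  rintro a ⟨ha, ha', -⟩
  rw [Subgroup.mem_center_iff]
  intro b
  ext1 <;> simp [ha, ha', add_comm]

theorem inv_mul_mem_centralSubgroup_top {a b : AffineCentralExtension}
    (h : a.translation = b.translation) (h' : a.scale = b.scale) :
    a⁻¹ * b ∈ centralSubgroup ⊤ := by
  simp [mem_centralSubgroup, h, h']

theorem central_commutator_of_scale_eq_one {a b : AffineCentralExtension}
    (ha : a.scale = 1) (hb : b.scale = 1) :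
    ⁅a, b⁆.central =
      invert a.translation * b.translation - invert b.translation * a.translation := by
  simp [commutatorElement_def, ha, hb]
  ring

end AffineCentralExtension

/-- A group is not finitely presented if it acts affinely on `ℤ[T;T⁻¹]`, with scalars `u` and
translation parts `x`, so that the translations by powers of `T` lift to commuting elements. -/
theorem not_isFinitelyPresented_of_affine {P : Type*} [Group P]
    (x : P → ℤ[T;T⁻¹]) (u : P →* ℤ[T;T⁻¹]ˣ) (hx : ∀ g h, x (g * h) = x g + u g * x h)
    (e : ℤ → P) (hxe : ∀ k, x (e k) = T k) (hue : ∀ k, u (e k) = 1)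
    (he : ∀ k l, Commute (e k) (e l)) : ¬ IsFinitelyPresented P := by
  intro hP
  obtain ⟨S, hS, hcomm⟩ := hP.exists_finset_commutator_mem_closure
    (AffineCentralExtension.centralSubgroup ⊤)
    (AffineCentralExtension.centralSubgroup_le_center _)
    (fun g => ⟨x g, u g, 0⟩)
    (fun g h => AffineCentralExtension.inv_mul_mem_centralSubgroup_top (hx g h) (map_mul u g h))
  obtain ⟨m, hm, hmS⟩ := (Set.Ioi_infinite (0 : ℤ)).exists_notMem_finset
    (S.biUnion fun a => a.central.coeff.support)
  let D : AddSubgroup ℤ[T;T⁻¹] :=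
    { carrier := {p | p.coeff m = 0}
      add_mem' := fun {p q} (hp : _ = _) (hq : _ = _) => by simp [hp, hq]
      zero_mem' := by simp
      neg_mem' := fun {p} (hp : _ = _) => by simp [hp] }
  have hle : Subgroup.closure (S : Set AffineCentralExtension) ≤
      AffineCentralExtension.centralSubgroup D := by
    refine (Subgroup.closure_le _).2 fun a ha => ⟨(hS ha).1, (hS ha).2.1, ?_⟩
    by_contra h
    exact hmS (Finset.mem_biUnion.2 ⟨a, ha, Finsupp.mem_support_iff.2 h⟩)
  have h : _ = (0 : ℤ) := (hle (hcomm _ _ (he 0 m))).2.2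
  rw [AffineCentralExtension.central_commutator_of_scale_eq_one (hue 0) (hue m)] at h
  have hm' : -m ≠ m := by have := Set.mem_Ioi.1 hm; omega
  simp [hxe, hm'] at h

theorem Matrix.commute_transvection {n R : Type*} [DecidableEq n] [Fintype n] [CommRing R]
    {i j : n} (hij : i ≠ j) (a b : R) :
    Commute (Matrix.transvection i j a) (Matrix.transvection i j b) := by
  rw [Commute, SemiconjBy, Matrix.transvection_mul_transvection_same _ _ hij,
    Matrix.transvection_mul_transvection_same _ _ hij, add_comm]

/-- Let A = ℤ[t,t⁻¹] and let P₂ ≤ GL₁₂(A) be the block upper triangular subgroup with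
diagonal blocks of sizes 5, 1, 1, 5 (0-based unrestricted blocks {0,…,4} and {7,…,11}).
Then P₂ is not finitely presented. -/
theorem blockParabolic_5115_not_finitelyPresented
    (P : Subgroup (Matrix.GeneralLinearGroup (Fin 12) (LaurentPolynomial ℤ)))
    (hP : ∀ g : Matrix.GeneralLinearGroup (Fin 12) (LaurentPolynomial ℤ), g ∈ P ↔
      ∀ i j : Fin 12, j < i →
        (i.val ≤ 4 ∧ j.val ≤ 4) ∨
        (7 ≤ i.val ∧ 7 ≤ j.val) ∨
        (g : Matrix (Fin 12) (Fin 12) (LaurentPolynomial ℤ)) i j = 0) :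
    ¬ IsFinitelyPresented ↥P := by
  have hlow (g : P) (i j : Fin 12) (hji : j < i) (hi : ¬ (i.val ≤ 4 ∧ j.val ≤ 4))
      (hj : ¬ (7 ≤ i.val ∧ 7 ≤ j.val)) : g.1.val i j = 0 := by
    rcases (hP g).1 g.2 i j hji with h | h | h
    exacts [(hi h).elim, (hj h).elim, h]
  have hmul (g h : P) (i k : Fin 12) (hi : 5 ≤ i.val) (hk : k.val ≤ 6) (hi' : i.val ≤ 6)
      (hk' : 5 ≤ k.val) :
      (g * h).1.val i k = g.1.val i 5 * h.1.val 5 k + g.1.val i 6 * h.1.val 6 k := by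
    change (g.1.val * h.1.val) i k = _
    rw [Matrix.mul_apply, ← Finset.sum_pair (f := fun j => g.1.val i j * h.1.val j k)
      (show (5 : Fin 12) ≠ 6 by decide)]
    refine (Finset.sum_subset (Finset.subset_univ _) fun j _ hj => ?_).symm
    simp only [Finset.mem_insert, Finset.mem_singleton, Fin.ext_iff] at hj
    by_cases hj5 : j.val < 5
    · rw [hlow g i j (by omega) (by omega) (by omega), zero_mul]
    · have : 6 < j.val := by
        have h5 : ((5 : Fin 12) : ℕ) = 5 := rfl
        have h6 : ((6 : Fin 12) : ℕ) = 6 := rfl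
        omega
      rw [hlow h j k (by omega) (by omega) (by omega), mul_zero]
  have h65 (g : P) : g.1.val 6 5 = 0 := hlow g 6 5 (by decide) (by decide) (by decide)
  let d₅ : P →* (LaurentPolynomial ℤ)ˣ := MonoidHom.toHomUnits
    { toFun := fun g => g.1.val 5 5
      map_one' := by simp
      map_mul' := fun g h => by
        rw [hmul g h 5 5 (by decide) (by decide) (by decide) (by decide), h65 h]; ring }
  let d₆ : P →* (LaurentPolynomial ℤ)ˣ := MonoidHom.toHomUnits
    { toFun := fun g => g.1.val 6 6
      map_one' := by simp
      map_mul' := fun g h => by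
        rw [hmul g h 6 6 (by decide) (by decide) (by decide) (by decide), h65 g]; ring }
  have hd₅ (g : P) : (d₅ g : LaurentPolynomial ℤ) = g.1.val 5 5 := rfl
  have hd₆ (g : P) : (d₆ g : LaurentPolynomial ℤ) = g.1.val 6 6 := rfl
  have h56 : (5 : Fin 12) ≠ 6 := by decide
  let E (k : ℤ) : Matrix.GeneralLinearGroup (Fin 12) (LaurentPolynomial ℤ) :=
    ⟨Matrix.transvection 5 6 (T k), Matrix.transvection 5 6 (-T k),
      by rw [Matrix.transvection_mul_transvection_same _ _ h56, add_neg_cancel,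
        Matrix.transvection_zero],
      by rw [Matrix.transvection_mul_transvection_same _ _ h56, neg_add_cancel,
        Matrix.transvection_zero]⟩
  have hE (k : ℤ) : (E k).val = Matrix.transvection 5 6 (T k) := rfl
  have hEP (k : ℤ) : E k ∈ P := by
    refine (hP _).2 fun i j hji => Or.inr (Or.inr ?_)
    rw [hE, Matrix.transvection, Matrix.add_apply, Matrix.one_apply_ne hji.ne',
      Matrix.single_apply_of_ne, add_zero]
    rintro ⟨rfl, rfl⟩
    exact absurd hji (by decide)
  refine not_isFinitelyPresented_of_affine
    (fun g => g.1.val 5 6 * ↑(d₆ g)⁻¹) (d₅ / d₆) (fun g h => ?_)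
    (fun k => ⟨E k, hEP k⟩) (fun k => ?_) (fun k => ?_) (fun k l => ?_)
  · simp only [map_mul, mul_inv, Units.val_mul, MonoidHom.div_apply, div_eq_mul_inv]
    rw [hmul g h 5 6 (by decide) (by decide) (by decide) (by decide), ← hd₅, ← hd₆]
    linear_combination (g.1.val 5 6 * ↑(d₆ g)⁻¹) * (d₆ h).mul_inv
  · have h : d₆ ⟨E k, hEP k⟩ = 1 := Units.ext (by simp [hd₆, hE, Matrix.transvection])
    simp [h, hE, Matrix.transvection]
  · have h₆ : d₆ ⟨E k, hEP k⟩ = 1 := Units.ext (by simp [hd₆, hE, Matrix.transvection])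
    have h₅ : d₅ ⟨E k, hEP k⟩ = 1 := Units.ext (by simp [hd₅, hE, Matrix.transvection])
    simp [h₅, h₆]
  · exact Subtype.ext (Units.ext (Matrix.commute_transvection h56 _ _))
end

section
/- Let F be a finite field. The subgroup of upper triangular matrices in SL₂(F[t,t⁻¹]) is not finitely presented. (This is the positive-characteristic case of the paper's theorem for a Borel subgroup of SL₂ over the ring of S-integers F[t,t⁻¹], which has |S| = 2 < 3.) -/
open LaurentPolynomial in
theorem LaurentPolynomial.exists_eq_C_mul_T_of_mul_eq_one {F : Type*} [Field F]
    {u v : LaurentPolynomial F} (h : u * v = 1) :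
    ∃ (c : F) (n : ℤ), u = C c * T n := by
  obtain ⟨n, p, hp⟩ := exists_T_pow u
  obtain ⟨m, q, hq⟩ := exists_T_pow v
  have hpq : p * q = Polynomial.X ^ (n + m) := by
    apply Polynomial.toLaurent_injective
    rw [map_mul, hp, hq, Polynomial.toLaurent_X_pow, Nat.cast_add, T_add]
    linear_combination (T (n : ℤ) * T (m : ℤ) : LaurentPolynomial F) * h
  obtain ⟨i, -, w, hw⟩ := (dvd_prime_pow Polynomial.prime_X _).1 ⟨q, hpq.symm⟩
  obtain ⟨c, -, hc⟩ := Polynomial.isUnit_iff.1 (w⁻¹).isUnit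
  refine ⟨c, (i : ℤ) - n, ?_⟩
  have hp' : p = Polynomial.C c * Polynomial.X ^ i := by
    rw [hc, ← hw, mul_comm p, ← mul_assoc, Units.inv_mul, one_mul]
  rw [hp', Polynomial.toLaurent_C_mul_X_pow] at hp
  rw [sub_eq_add_neg, T_add, ← mul_assoc, hp, mul_T_assoc, add_neg_cancel, T_zero, mul_one]

/-- The upper triangular matrices `!![u, f; 0, v]` of determinant one over `F[t,t⁻¹]`, together
with an extra coordinate `z`. The group structure comes from identifying such a tuple with
`!![u, f, z; 0, v, v * v̄ * f̄; 0, 0, v * v̄ ^ 2]`, where the bar is the substitution `t ↦ t⁻¹`. -/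
@[ext]
structure HeisenbergBorel (F : Type*) [Field F] where
  /-- The first diagonal entry. -/
  u : LaurentPolynomial F
  /-- The second diagonal entry. -/
  v : LaurentPolynomial F
  /-- The off-diagonal entry of the Borel quotient. -/
  f : LaurentPolynomial F
  /-- The coordinate on the kernel of the projection to the Borel group. -/
  z : LaurentPolynomial F
  mul_eq_one : u * v = 1

namespace HeisenbergBorel

open LaurentPolynomial

variable {F : Type*} [Field F]

noncomputable instance : One (HeisenbergBorel F) := ⟨⟨1, 1, 0, 0, mul_one 1⟩⟩

noncomputable instance : Mul (HeisenbergBorel F) where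
  mul a b :=
    { u := a.u * b.u
      v := a.v * b.v
      f := a.u * b.f + a.f * b.v
      z := a.u * b.z + a.f * (b.v * invert b.v * invert b.f) + a.z * (b.v * invert b.v ^ 2)
      mul_eq_one := by linear_combination b.u * b.v * a.mul_eq_one + b.mul_eq_one }

noncomputable instance : Inv (HeisenbergBorel F) where
  inv a :=
    { u := a.v
      v := a.u
      f := -a.f
      z := invert a.u * a.f * invert a.f - invert a.u ^ 2 * a.z
      mul_eq_one := by rw [mul_comm, a.mul_eq_one] }

@[simp] lemma one_u : (1 : HeisenbergBorel F).u = 1 := rfl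
@[simp] lemma one_v : (1 : HeisenbergBorel F).v = 1 := rfl
@[simp] lemma one_f : (1 : HeisenbergBorel F).f = 0 := rfl
@[simp] lemma one_z : (1 : HeisenbergBorel F).z = 0 := rfl
@[simp] lemma mul_u (a b : HeisenbergBorel F) : (a * b).u = a.u * b.u := rfl
@[simp] lemma mul_v (a b : HeisenbergBorel F) : (a * b).v = a.v * b.v := rfl
@[simp] lemma mul_f (a b : HeisenbergBorel F) : (a * b).f = a.u * b.f + a.f * b.v := rfl
@[simp] lemma mul_z (a b : HeisenbergBorel F) : (a * b).z =
    a.u * b.z + a.f * (b.v * invert b.v * invert b.f) + a.z * (b.v * invert b.v ^ 2) := rfl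
@[simp] lemma inv_u (a : HeisenbergBorel F) : (a⁻¹).u = a.v := rfl
@[simp] lemma inv_v (a : HeisenbergBorel F) : (a⁻¹).v = a.u := rfl
@[simp] lemma inv_f (a : HeisenbergBorel F) : (a⁻¹).f = -a.f := rfl
@[simp] lemma inv_z (a : HeisenbergBorel F) :
    (a⁻¹).z = invert a.u * a.f * invert a.f - invert a.u ^ 2 * a.z := rfl

lemma invert_mul_eq_one (a : HeisenbergBorel F) : invert a.u * invert a.v = 1 := by
  rw [← map_mul, a.mul_eq_one, map_one]

noncomputable instance : Group (HeisenbergBorel F) :=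
  Group.ofLeftAxioms
    (fun a b c => by
      ext1 <;> simp only [mul_u, mul_v, mul_f, mul_z, map_mul, map_add]
      · ring
      · ring
      · ring
      · linear_combination (-(a.f * c.v * invert c.v * invert c.f * b.v)) * b.invert_mul_eq_one)
    (fun a => by ext1 <;> simp)
    (fun a => by
      have h := a.mul_eq_one
      have h' := a.invert_mul_eq_one
      ext1 <;> simp only [mul_u, mul_v, mul_f, mul_z, one_u, one_v, one_f, one_z, inv_u, inv_v,
        inv_f, inv_z]
      · linear_combination h
      · linear_combination h
      · ring
      · linear_combination (a.f * a.v * invert a.v * invert a.f - a.z * a.v *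
          (invert a.u * invert a.v + 1)) * h')

/-- The projection onto the upper triangular part. -/
noncomputable def toSL :
    HeisenbergBorel F →* Matrix.SpecialLinearGroup (Fin 2) (LaurentPolynomial F) where
  toFun a := ⟨!![a.u, a.f; 0, a.v], by simp [Matrix.det_fin_two_of, a.mul_eq_one]⟩
  map_one' := by
    ext i j; fin_cases i <;> fin_cases j <;> simp
  map_mul' a b := by
    apply Subtype.ext
    change !![_, _; 0, _] = !![a.u, a.f; 0, a.v] * !![b.u, b.f; 0, b.v]
    simp

lemma coe_toSL (a : HeisenbergBorel F) :
    (toSL a : Matrix (Fin 2) (Fin 2) (LaurentPolynomial F)) = !![a.u, a.f; 0, a.v] := rfl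

lemma exists_toSL_eq {g : Matrix.SpecialLinearGroup (Fin 2) (LaurentPolynomial F)}
    (hg : (g : Matrix (Fin 2) (Fin 2) (LaurentPolynomial F)) 1 0 = 0) :
    ∃ a : HeisenbergBorel F, toSL a = g := by
  have hdet := g.det_coe
  rw [Matrix.det_fin_two, hg, mul_zero, sub_zero] at hdet
  refine ⟨⟨g.1 0 0, g.1 1 1, g.1 0 1, 0, hdet⟩, ?_⟩
  ext i j
  rw [coe_toSL]
  fin_cases i <;> fin_cases j <;> simp [hg]

lemma toSL_eq_iff {a b : HeisenbergBorel F} :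
    toSL a = toSL b ↔ a.u = b.u ∧ a.v = b.v ∧ a.f = b.f := by
  refine ⟨fun h => ?_, fun ⟨hu, hv, hf⟩ => ?_⟩
  · have h' := congrArg (fun g : Matrix.SpecialLinearGroup (Fin 2) (LaurentPolynomial F) => g.1) h
    refine ⟨congrFun₂ h' 0 0, congrFun₂ h' 1 1, congrFun₂ h' 0 1⟩
  · apply Subtype.ext
    rw [coe_toSL, coe_toSL, hu, hv, hf]

lemma toSL_eq_one_iff {a : HeisenbergBorel F} :
    toSL a = 1 ↔ a.u = 1 ∧ a.v = 1 ∧ a.f = 0 := by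
  rw [← map_one toSL, toSL_eq_iff]; rfl

/-- The elements of the kernel of the projection whose last coordinate lies in `V`. -/
def kernelSubgroup (V : Submodule F (LaurentPolynomial F)) : Subgroup (HeisenbergBorel F) where
  carrier := {a | (a.u = 1 ∧ a.v = 1 ∧ a.f = 0) ∧ a.z ∈ V}
  one_mem' := by simp
  mul_mem' := by
    rintro a b ⟨⟨ha, ha', ha''⟩, haz⟩ ⟨⟨hb, hb', hb''⟩, hbz⟩
    simpa [ha, ha', ha'', hb, hb', hb''] using V.add_mem hbz haz
  inv_mem' := by
    rintro a ⟨⟨ha, ha', ha''⟩, haz⟩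
    simpa [ha, ha', ha''] using haz

lemma mem_kernelSubgroup {V : Submodule F (LaurentPolynomial F)} {a : HeisenbergBorel F} :
    a ∈ kernelSubgroup V ↔ toSL a = 1 ∧ a.z ∈ V := by
  rw [toSL_eq_one_iff]; rfl

lemma exists_u_mul_invert_eq_C (a : HeisenbergBorel F) : ∃ c : F, a.u * invert a.u = C c := by
  obtain ⟨c, n, h⟩ := exists_eq_C_mul_T_of_mul_eq_one a.mul_eq_one
  refine ⟨c * c, ?_⟩
  have hT : (T n * T (-n) : LaurentPolynomial F) = 1 := by
    rw [← T_add, add_neg_cancel, T_zero]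
  rw [h, map_mul, invert_C, invert_T, map_mul]
  linear_combination (C c * C c) * hT

instance (V : Submodule F (LaurentPolynomial F)) : (kernelSubgroup V).Normal where
  conj_mem k hk a := by
    rw [mem_kernelSubgroup] at hk ⊢
    obtain ⟨hk1, hkz⟩ := hk
    refine ⟨by simp [hk1], ?_⟩
    obtain ⟨hu, hv, hf⟩ := toSL_eq_one_iff.1 hk1
    obtain ⟨c, hc⟩ := a.exists_u_mul_invert_eq_C
    have key : (a * k * a⁻¹).z = (c ^ 2) • k.z := by
      rw [smul_eq_C_mul, map_pow, ← hc]
      simp only [mul_z, mul_u, mul_f, inv_z, inv_v, inv_f, hu, hv, hf, map_neg, map_one, map_zero]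
      ring
    rw [key]
    exact V.smul_mem _ hkz

open scoped commutatorElement in
lemma commutator_z {a b : HeisenbergBorel F} (hau : a.u = 1) (hav : a.v = 1) (hbu : b.u = 1)
    (hbv : b.v = 1) : ⁅a, b⁆.z = a.f * invert b.f - b.f * invert a.f := by
  simp only [commutatorElement_def, mul_z, mul_u, mul_f, inv_u, inv_z, inv_v, inv_f, hau,
    hav, hbu, hbv, map_neg, map_one]
  ring

end HeisenbergBorel

lemma LaurentPolynomial.T_sub_T_neg_injective (F : Type*) [Field F] :
    Function.Injective
      fun n : ℕ => (T ((n : ℤ) + 1) - T (-((n : ℤ) + 1)) : LaurentPolynomial F) := by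
  intro m n h
  by_contra hmn
  have h1 := congrArg (fun p : LaurentPolynomial F => p.coeff ((m : ℤ) + 1)) h
  have e1 : -((m : ℤ) + 1) ≠ m + 1 := by omega
  have e2 : -((n : ℤ) + 1) ≠ m + 1 := by omega
  have e3 : ((n : ℤ) + 1) ≠ m + 1 := by omega
  simp only [AddMonoidAlgebra.coeff_sub, Finsupp.sub_apply, T_apply, if_neg e1, if_neg e2,
    if_neg e3, if_true, sub_zero] at h1
  exact one_ne_zero h1

/-- The subgroup of upper triangular matrices in SL₂(F[t,t⁻¹]), F a finite field, is
not finitely presented. -/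
theorem borelSL2_laurent_not_finitelyPresented
    (F : Type*) [Field F] [Finite F]
    (B : Subgroup (Matrix.SpecialLinearGroup (Fin 2) (LaurentPolynomial F)))
    (hB : ∀ g : Matrix.SpecialLinearGroup (Fin 2) (LaurentPolynomial F), g ∈ B ↔
      (g : Matrix (Fin 2) (Fin 2) (LaurentPolynomial F)) 1 0 = 0) :
    ¬ IsFinitelyPresented ↥B := by
  open HeisenbergBorel LaurentPolynomial commutatorElement in
  rintro ⟨m, S, ⟨e⟩⟩
  let φ : FreeGroup (Fin m) →* B := e.toMonoidHom.comp (QuotientGroup.mk' _)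
  have hφ : Function.Surjective φ := e.surjective.comp (QuotientGroup.mk'_surjective _)
  have hker (w) (hw : φ w = 1) : w ∈ Subgroup.normalClosure (S : Set (FreeGroup (Fin m))) := by
    rw [← QuotientGroup.eq_one_iff]
    exact e.injective (hw.trans (map_one e).symm)
  choose s hs using fun i => exists_toSL_eq ((hB _).1 (φ (FreeGroup.of i)).2)
  let ψ : FreeGroup (Fin m) →* HeisenbergBorel F := FreeGroup.lift s
  have hψ (w) : toSL (ψ w) = φ w := by
    have : toSL.comp ψ = B.subtype.comp φ := FreeGroup.ext_hom _ _ fun i => by simp [ψ, hs]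
    exact DFunLike.congr_fun this w
  let V : Submodule F (LaurentPolynomial F) := Submodule.span F ((fun w => (ψ w).z) '' S)
  have hS : Subgroup.normalClosure (S : Set (FreeGroup (Fin m))) ≤ (kernelSubgroup V).comap ψ := by
    refine Subgroup.normalClosure_le_normal fun w hw => mem_kernelSubgroup.2 ⟨?_, ?_⟩
    · have : φ w = 1 := by
        have : (w : FreeGroup (Fin m) ⧸ Subgroup.normalClosure (S : Set (FreeGroup (Fin m)))) = 1 :=
          (QuotientGroup.eq_one_iff _).2 (Subgroup.subset_normalClosure hw)
        exact (congrArg e this).trans (map_one e)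
      rw [hψ, this, OneMemClass.coe_one]
    · exact Submodule.subset_span ⟨w, hw, rfl⟩
  have hlift (f : LaurentPolynomial F) :
      ∃ w, (ψ w).u = 1 ∧ (ψ w).v = 1 ∧ (ψ w).f = f := by
    let a : HeisenbergBorel F := ⟨1, 1, f, 0, mul_one 1⟩
    obtain ⟨w, hw⟩ := hφ ⟨toSL a, (hB _).2 rfl⟩
    exact ⟨w, toSL_eq_iff.1 ((hψ w).trans (congrArg Subtype.val hw))⟩
  have hV (f : LaurentPolynomial F) : f - invert f ∈ V := by
    obtain ⟨x, hxu, hxv, hxf⟩ := hlift f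
    obtain ⟨y, hyu, hyv, hyf⟩ := hlift 1
    have hz : (ψ ⁅x, y⁆).z = f - invert f := by
      rw [map_commutatorElement, commutator_z hxu hxv hyu hyv, hxf, hyf, map_one, mul_one, one_mul]
    have h1 : φ ⁅x, y⁆ = 1 := by
      apply Subtype.ext
      rw [← hψ, OneMemClass.coe_one, toSL_eq_one_iff, map_commutatorElement, commutatorElement_def]
      simp only [mul_u, mul_v, mul_f, inv_u, inv_v, inv_f, hxu, hxv, hyu, hyv]
      refine ⟨by ring, by ring, by ring⟩
    exact hz ▸ (mem_kernelSubgroup.1 (hS (hker _ h1))).2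
  have : Module.Finite F V := Module.Finite.span_of_finite F (S.finite_toSet.image _)
  have : Finite V := Module.finite_of_finite F
  refine not_injective_infinite_finite
    (fun n : ℕ => (⟨T ((n : ℤ) + 1) - T (-((n : ℤ) + 1)), ?_⟩ : V))
    fun a b h => T_sub_T_neg_injective F (congrArg Subtype.val h)
  simpa using hV (T ((n : ℤ) + 1))
end

section
/- Let F be a finite field, let b ≥ 2 be an integer, set n = 2 + b and I = {1,…,n−1} \ {2}. Then the standard maximal parabolic subgroup P_I(F[t,t⁻¹]) ≤ SL_n(F[t,t⁻¹]), whose Levi factor has diagonal blocks of sizes 2 and b, is not finitely presented. -/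
/-- If `σ k` is a sequence of maps from a finitely presented group which is eventually
multiplicative on each pair of elements, then for large `k` the map `σ k` agrees with a
homomorphism on any two prescribed elements. -/
theorem IsFinitelyPresented.eventually_exists_hom {G : Type*} {E : Type*} [Group G] [Group E]
    (hG : IsFinitelyPresented G) (σ : ℕ → G → E)
    (hσ : ∀ g h : G, ∀ᶠ k in Filter.atTop, σ k (g * h) = σ k g * σ k h) (d e : G) :
    ∀ᶠ k in Filter.atTop, ∃ ρ : G →* E, ρ d = σ k d ∧ ρ e = σ k e := by
  obtain ⟨m, S, ⟨iso⟩⟩ := hG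
  let q : FreeGroup (Fin m) →* G :=
    iso.toMonoidHom.comp (QuotientGroup.mk' (Subgroup.normalClosure (S : Set (FreeGroup (Fin m)))))
  have hq : Function.Surjective q :=
    iso.surjective.comp (QuotientGroup.mk'_surjective _)
  let φ : ℕ → FreeGroup (Fin m) →* E := fun k => FreeGroup.lift fun x => σ k (q (FreeGroup.of x))
  have hone : ∀ᶠ k in Filter.atTop, σ k 1 = 1 := by
    filter_upwards [hσ 1 1] with k hk
    simpa using hk
  have hφ : ∀ w : FreeGroup (Fin m), ∀ᶠ k in Filter.atTop, φ k w = σ k (q w) := by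
    intro w
    induction w using FreeGroup.induction_on with
    | C1 => filter_upwards [hone] with k hk; simp [hk]
    | of x => exact Filter.Eventually.of_forall fun k => by simp [φ]
    | inv_of x ih =>
      filter_upwards [ih, hone, hσ (q (FreeGroup.of x)) (q (FreeGroup.of x))⁻¹] with k h1 h2 h3
      rw [mul_inv_cancel, h2] at h3
      rw [map_inv, map_inv, h1, inv_eq_iff_mul_eq_one, ← h3]
    | mul x y hx hy =>
      filter_upwards [hx, hy, hσ (q x) (q y)] with k h1 h2 h3
      rw [map_mul, map_mul, h1, h2, h3]
  obtain ⟨d', rfl⟩ := hq d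
  obtain ⟨e', rfl⟩ := hq e
  have hS : ∀ᶠ k in Filter.atTop, ∀ r ∈ S, φ k r = 1 := by
    rw [Filter.eventually_all_finset]
    intro r hr
    have hqr : q r = 1 := by
      have : (QuotientGroup.mk' (Subgroup.normalClosure (S : Set (FreeGroup (Fin m))))) r = 1 :=
        (QuotientGroup.eq_one_iff r).2 (Subgroup.subset_normalClosure hr)
      simp only [q, MonoidHom.comp_apply, this, map_one]
    filter_upwards [hφ r, hone] with k h1 h2
    rw [h1, hqr, h2]
  filter_upwards [hS, hφ d', hφ e'] with k hk hd he
  have hker : Subgroup.normalClosure (S : Set (FreeGroup (Fin m))) ≤ (φ k).ker :=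
    Subgroup.normalClosure_le_normal fun r hr => hk r hr
  refine ⟨(QuotientGroup.lift _ (φ k) hker).comp iso.symm.toMonoidHom, ?_, ?_⟩
  · rw [← hd]; simp [q]
  · rw [← he]; simp [q]

/-- The permutation of `G × ℤ` lifting left multiplication by `g`, where the integer coordinate
records the changes of `χ'` weighted by `χ`. -/
def windingPerm {G : Type*} [Group G] (χ χ' : G → ℤ) (g : G) : Equiv.Perm (G × ℤ) where
  toFun p := (g * p.1, p.2 + χ p.1 * (χ' (g * p.1) - χ' p.1))
  invFun p := (g⁻¹ * p.1, p.2 - χ (g⁻¹ * p.1) * (χ' p.1 - χ' (g⁻¹ * p.1)))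
  left_inv p := by simp
  right_inv p := by simp

theorem windingPerm_apply {G : Type*} [Group G] (χ χ' : G → ℤ) (g y : G) (j : ℤ) :
    windingPerm χ χ' g (y, j) = (g * y, j + χ y * (χ' (g * y) - χ' y)) := rfl

theorem windingPerm_mul {G : Type*} [Group G] {χ χ' : G → ℤ} {g h : G}
    (H : ∀ y, χ (h * y) = χ y ∨ χ' (g * (h * y)) = χ' (h * y)) :
    windingPerm χ χ' (g * h) = windingPerm χ χ' g * windingPerm χ χ' h := by
  ext1 ⟨y, j⟩
  rw [Equiv.Perm.mul_apply]
  simp only [windingPerm_apply, mul_assoc, Prod.mk.injEq, true_and]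
  rcases H y with H | H
  · rw [H]; ring
  · rw [H]; ring

theorem windingPerm_pow_apply {G : Type*} [Group G] {χ χ' : G → ℤ} {g y : G} {n : ℕ}
    (H : ∀ i < n, χ (g ^ i * y) = 0 ∨ χ' (g ^ (i + 1) * y) = χ' (g ^ i * y)) (j : ℤ) :
    (windingPerm χ χ' g ^ n) (y, j) = (g ^ n * y, j) := by
  induction n with
  | zero => simp
  | succ n ih =>
    rw [pow_succ', Equiv.Perm.mul_apply, ih fun i hi => H i (by omega), windingPerm_apply,
      ← mul_assoc, ← pow_succ']
    rcases H n (by omega) with h | h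
    · simp [h]
    · simp [h]

/-- The minimum of the valuations of the entries of a column. -/
def colVal {R : Type*} [Ring R] (v : AddValuation R (WithTop ℤ))
    (z : Matrix (Fin 2) (Fin 2) R) (p : Fin 2) : WithTop ℤ :=
  min (v (z 0 p)) (v (z 1 p))

theorem colVal_le {R : Type*} [Ring R] (v : AddValuation R (WithTop ℤ))
    (z : Matrix (Fin 2) (Fin 2) R) (i p : Fin 2) : colVal v z p ≤ v (z i p) := by
  fin_cases i
  · exact min_le_left _ _
  · exact min_le_right _ _

theorem exists_colVal_eq {R : Type*} [Ring R] (v : AddValuation R (WithTop ℤ))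
    (z : Matrix (Fin 2) (Fin 2) R) (p : Fin 2) : ∃ i, v (z i p) = colVal v z p := by
  rcases min_choice (v (z 0 p)) (v (z 1 p)) with h | h
  · exact ⟨0, h.symm⟩
  · exact ⟨1, h.symm⟩

section Valuation

variable {R : Type*} [CommRing R] (v : AddValuation R (WithTop ℤ))

theorem exists_int_colVal {z : Matrix (Fin 2) (Fin 2) R} (hz : v z.det ≠ ⊤) (p : Fin 2) :
    ∃ n : ℤ, colVal v z p = n := by
  by_contra! h
  have htop : colVal v z p = ⊤ := by
    cases hc : colVal v z p with
    | top => rfl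
    | coe a => exact absurd hc (h a)
  have hent : ∀ i, v (z i p) = ⊤ := fun i => top_le_iff.1 (htop ▸ colVal_le v z i p)
  apply hz
  rw [← top_le_iff, Matrix.det_fin_two]
  apply v.map_le_sub
  all_goals
    rw [v.map_mul]
    fin_cases p <;> simp_all

theorem add_colVal_le_colVal_mul {g : Matrix (Fin 2) (Fin 2) R} {c : WithTop ℤ}
    (hg : ∀ i j, c ≤ v (g i j)) (z : Matrix (Fin 2) (Fin 2) R) (p : Fin 2) :
    c + colVal v z p ≤ colVal v (g * z) p := by
  have key : ∀ i, c + colVal v z p ≤ v ((g * z) i p) := by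
    intro i
    rw [Matrix.mul_apply, Fin.sum_univ_two]
    apply v.map_le_add <;> rw [v.map_mul] <;> exact add_le_add (hg _ _) (colVal_le v z _ p)
  exact le_min (key 0) (key 1)

theorem exists_valuation_minor_eq (g z : Matrix (Fin 2) (Fin 2) R) {p q : Fin 2} (hpq : p ≠ q)
    (i r : Fin 2) : ∃ s, v (z r q * (g * z) i p - z r p * (g * z) i q) = v (g i s) + v z.det := by
  have hneg : ∀ x y : R, x = -y → v x = v y := fun x y h => by rw [h, v.map_neg]
  refine ⟨1 - r, ?_⟩
  rw [← v.map_mul, Matrix.det_fin_two]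
  simp only [Matrix.mul_apply, Fin.sum_univ_two]
  fin_cases p <;> fin_cases q <;> first | exact absurd rfl hpq | skip
  all_goals fin_cases r
  all_goals first
    | (apply congrArg v; simp; ring1)
    | (apply hneg; simp; ring1)

theorem valuation_det_le_of_sub_lt {g z : Matrix (Fin 2) (Fin 2) R} {p q : Fin 2} (hpq : p ≠ q)
    {c δ n₁ n₂ m₁ m₂ : ℤ} (hg : ∀ i j, ((-c : ℤ) : WithTop ℤ) ≤ v (g i j))
    (hδ : v z.det = δ) (hn₁ : colVal v z p = n₁) (hn₂ : colVal v z q = n₂)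
    (hm₁ : colVal v (g * z) p = m₁) (hm₂ : colVal v (g * z) q = m₂) (h : m₁ - m₂ < n₁ - n₂) :
    δ ≤ n₂ + m₁ + c := by
  obtain ⟨r, hr⟩ := exists_colVal_eq v z q
  obtain ⟨i, hi⟩ := exists_colVal_eq v (g * z) p
  obtain ⟨s, hs⟩ := exists_valuation_minor_eq v g z hpq i r
  have h1 : v (z r q * (g * z) i p) = ((n₂ + m₁ : ℤ) : WithTop ℤ) := by
    rw [v.map_mul, hr, hi, hn₂, hm₁]; rfl
  have h2 : ((n₁ + m₂ : ℤ) : WithTop ℤ) ≤ v (z r p * (g * z) i q) := by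
    rw [v.map_mul, WithTop.coe_add, ← hn₁, ← hm₂]
    exact add_le_add (colVal_le v z r p) (colVal_le v (g * z) i q)
  have h3 : v (z r q * (g * z) i p) < v (z r p * (g * z) i q) := by
    refine lt_of_lt_of_le ?_ h2
    rw [h1, WithTop.coe_lt_coe]
    omega
  rw [v.map_sub_eq_of_lt_left h3, h1, hδ] at hs
  have h4 : ((-c + δ : ℤ) : WithTop ℤ) ≤ ((n₂ + m₁ : ℤ) : WithTop ℤ) := by
    rw [hs, WithTop.coe_add]
    exact add_le_add (hg i s) le_rfl
  rw [WithTop.coe_le_coe] at h4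
  omega

/-- Membership of the vertex `z` of the Bruhat–Tits tree of `v` in the half-tree of level `κ`
on the line joining `0` to `∞`. -/
def InHalfTree (κ : ℤ) (z : Matrix (Fin 2) (Fin 2) R) : Prop :=
  colVal v z 1 + κ ≤ colVal v z 0

theorem bounds_of_inHalfTree_ne {g h z : Matrix (Fin 2) (Fin 2) R} {c δ κ : ℤ}
    (hg : ∀ i j, ((-c : ℤ) : WithTop ℤ) ≤ v (g i j))
    (hh : ∀ i j, ((-c : ℤ) : WithTop ℤ) ≤ v (h i j)) (hgh : h * g = 1)
    (hδ : v z.det = δ) (hne : ¬ (InHalfTree v κ (g * z) ↔ InHalfTree v κ z)) :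
    ∃ n₁ n₂ : ℤ, colVal v z 0 = n₁ ∧ colVal v z 1 = n₂ ∧ δ ≤ n₁ + n₂ + 2 * c ∧
      n₁ - n₂ ≤ κ + 2 * c ∧ κ - 2 * c ≤ n₁ - n₂ := by
  have hz : h * (g * z) = z := by rw [← mul_assoc, hgh, one_mul]
  have hzt : v z.det ≠ ⊤ := by rw [hδ]; exact WithTop.coe_ne_top
  have hgzt : v (g * z).det ≠ ⊤ := by
    intro H
    apply hzt
    rw [← hz, Matrix.det_mul, v.map_mul, H, add_top]
  obtain ⟨n₁, hn₁⟩ := exists_int_colVal v hzt 0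
  obtain ⟨n₂, hn₂⟩ := exists_int_colVal v hzt 1
  obtain ⟨m₁, hm₁⟩ := exists_int_colVal v hgzt 0
  obtain ⟨m₂, hm₂⟩ := exists_int_colVal v hgzt 1
  have a1 := add_colVal_le_colVal_mul v hg z 0
  have a2 := add_colVal_le_colVal_mul v hg z 1
  have b1 := add_colVal_le_colVal_mul v hh (g * z) 0
  have b2 := add_colVal_le_colVal_mul v hh (g * z) 1
  rw [hz] at b1 b2
  unfold InHalfTree at hne
  rw [hn₁, hn₂, hm₁, hm₂] at hne
  rw [hn₁, hm₁] at a1 b1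
  rw [hn₂, hm₂] at a2 b2
  norm_cast at a1 a2 b1 b2 hne
  refine ⟨n₁, n₂, hn₁, hn₂, ?_⟩
  rcases lt_or_ge (m₁ - m₂) (n₁ - n₂) with hlt | hge
  · have := valuation_det_le_of_sub_lt v zero_ne_one hg hδ hn₁ hn₂ hm₁ hm₂ hlt
    by_cases h1 : m₂ + κ ≤ m₁ <;> by_cases h2 : n₂ + κ ≤ n₁ <;>
      simp only [h1, h2, not_true, iff_true, iff_false, not_false_iff] at hne <;> omega
  · by_cases h1 : m₂ + κ ≤ m₁ <;> by_cases h2 : n₂ + κ ≤ n₁ <;>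
      simp only [h1, h2, not_true, iff_true, iff_false, not_false_iff] at hne
    · have := valuation_det_le_of_sub_lt v one_ne_zero hg hδ hn₂ hn₁ hm₂ hm₁ (by omega)
      omega
    · omega

theorem exists_int_neg_le (g : Matrix (Fin 2) (Fin 2) R) :
    ∃ c : ℤ, ∀ i j, ((-c : ℤ) : WithTop ℤ) ≤ v (g i j) := by
  have key : ∀ x : WithTop ℤ, ∃ c : ℤ, ∀ c' ≥ c, ((-c' : ℤ) : WithTop ℤ) ≤ x := by
    intro x
    cases x with
    | top => exact ⟨0, fun _ _ => le_top⟩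
    | coe a => exact ⟨-a, fun c' hc => by rw [WithTop.coe_le_coe]; omega⟩
  choose f hf using fun i j => key (v (g i j))
  refine ⟨∑ i, ∑ j, |f i j|, fun i j => hf i j _ ?_⟩
  calc f i j ≤ |f i j| := le_abs_self _
    _ ≤ ∑ j, |f i j| := Finset.single_le_sum (f := fun j => |f i j|)
        (fun _ _ => abs_nonneg _) (Finset.mem_univ j)
    _ ≤ _ := Finset.single_le_sum (f := fun i => ∑ j, |f i j|)
        (fun _ _ => Finset.sum_nonneg fun _ _ => abs_nonneg _) (Finset.mem_univ i)

end Valuation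

section TwoPlaces

variable {R : Type*} [CommRing R] {v v' : AddValuation R (WithTop ℤ)}

theorem exists_int_valuation_unit (hvv : ∀ f : R, f ≠ 0 → v f + v' f ≤ 0) [Nontrivial R]
    {u : R} (hu : IsUnit u) : ∃ a : ℤ, v u = a ∧ v' u = ((-a : ℤ) : WithTop ℤ) := by
  obtain ⟨w, hw⟩ := hu.exists_right_inv
  have hu0 : u ≠ 0 := hu.ne_zero
  have hw0 : w ≠ 0 := by rintro rfl; simp at hw
  have h1 := hvv u hu0
  have h2 := hvv w hw0
  have h3 : v u + v w = 0 := by rw [← v.map_mul, hw, v.map_one]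
  have h4 : v' u + v' w = 0 := by rw [← v'.map_mul, hw, v'.map_one]
  generalize v u = a at *
  generalize v' u = a' at *
  generalize v w = b at *
  generalize v' w = b' at *
  cases a <;> cases a' <;> cases b <;> cases b' <;>
    try simp_all only [WithTop.top_add, WithTop.add_top, WithTop.top_ne_zero, top_le_iff,
      WithTop.zero_ne_top]
  norm_cast at h1 h2 h3 h4
  exact ⟨_, rfl, by rw [WithTop.coe_inj]; omega⟩

theorem colVal_add_colVal_le (hvv : ∀ f : R, f ≠ 0 → v f + v' f ≤ 0)
    {z : Matrix (Fin 2) (Fin 2) R} {p : Fin 2} {n n' : ℤ} (hn : colVal v z p = n)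
    (hn' : colVal v' z p = n') : n + n' ≤ 0 := by
  obtain ⟨i, hi⟩ := exists_colVal_eq v z p
  have h0 : z i p ≠ 0 := by
    intro h
    rw [h, v.map_zero, hn] at hi
    exact WithTop.coe_ne_top hi.symm
  have h1 := (add_le_add hi.ge (colVal_le v' z i p)).trans (hvv _ h0)
  rw [hn, hn'] at h1
  exact_mod_cast h1

theorem eventually_inHalfTree_iff_or [Nontrivial R] (hvv : ∀ f : R, f ≠ 0 → v f + v' f ≤ 0)
    {A A' B B' : Matrix (Fin 2) (Fin 2) R} (hA : A' * A = 1) (hB : B' * B = 1) (κ : ℤ) :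
    ∀ᶠ k : ℕ in Filter.atTop, ∀ z : Matrix (Fin 2) (Fin 2) R, IsUnit z.det →
      (InHalfTree v κ (A * z) ↔ InHalfTree v κ z) ∨
        (InHalfTree v' (-k) (B * z) ↔ InHalfTree v' (-k) z) := by
  obtain ⟨c₁, h₁⟩ := exists_int_neg_le v A
  obtain ⟨c₂, h₂⟩ := exists_int_neg_le v A'
  obtain ⟨c₃, h₃⟩ := exists_int_neg_le v' B
  obtain ⟨c₄, h₄⟩ := exists_int_neg_le v' B'
  have weaken : ∀ {a b : ℤ} {x : WithTop ℤ}, a ≤ b → ((-a : ℤ) : WithTop ℤ) ≤ x →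
      ((-b : ℤ) : WithTop ℤ) ≤ x := fun hab hx =>
    le_trans (WithTop.coe_le_coe.2 (by omega)) hx
  let c := max c₁ c₂
  let c' := max c₃ c₄
  filter_upwards [Filter.eventually_gt_atTop (4 * c + 4 * c' + κ).toNat] with k hk z hz
  by_contra! hne
  obtain ⟨δ, hδ, hδ'⟩ := exists_int_valuation_unit hvv hz
  obtain ⟨n₁, n₂, hn₁, hn₂, i1, i2, i3⟩ := bounds_of_inHalfTree_ne v
    (fun i j => weaken (le_max_left c₁ c₂) (h₁ i j))
    (fun i j => weaken (le_max_right c₁ c₂) (h₂ i j)) hA hδ (by tauto)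
  obtain ⟨m₁, m₂, hm₁, hm₂, j1, j2, j3⟩ := bounds_of_inHalfTree_ne v'
    (fun i j => weaken (le_max_left c₃ c₄) (h₃ i j))
    (fun i j => weaken (le_max_right c₃ c₄) (h₄ i j)) hB hδ' (by tauto)
  have k1 := colVal_add_colVal_le hvv hn₁ hm₁
  have k2 := colVal_add_colVal_le hvv hn₂ hm₂
  omega

open Classical in
/-- The indicator function of a half-tree. -/
noncomputable def halfTreeInd (v : AddValuation R (WithTop ℤ)) (κ : ℤ)
    (z : Matrix (Fin 2) (Fin 2) R) : ℤ :=
  if InHalfTree v κ z then 1 else 0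

theorem halfTreeInd_congr {κ : ℤ} {y z : Matrix (Fin 2) (Fin 2) R}
    (h : InHalfTree v κ y ↔ InHalfTree v κ z) : halfTreeInd v κ y = halfTreeInd v κ z := by
  unfold halfTreeInd
  congr 1
  exact propext h

theorem eventually_windingPerm_mul [Nontrivial R] (hvv : ∀ f : R, f ≠ 0 → v f + v' f ≤ 0)
    {G : Type*} [Group G] (θ : G →* Matrix (Fin 2) (Fin 2) R) (κ : ℤ) (g h : G) :
    ∀ᶠ k : ℕ in Filter.atTop,
      windingPerm (fun y => halfTreeInd v κ (θ y)) (fun y => halfTreeInd v' (-k) (θ y)) (g * h) =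
      windingPerm (fun y => halfTreeInd v κ (θ y)) (fun y => halfTreeInd v' (-k) (θ y)) g *
      windingPerm (fun y => halfTreeInd v κ (θ y)) (fun y => halfTreeInd v' (-k) (θ y)) h := by
  have hA : θ h * θ h⁻¹ = 1 := by rw [← map_mul, mul_inv_cancel, map_one]
  have hB : θ g⁻¹ * θ g = 1 := by rw [← map_mul, inv_mul_cancel, map_one]
  filter_upwards [eventually_inHalfTree_iff_or hvv hA hB κ] with k hk
  apply windingPerm_mul
  intro y
  have hu : IsUnit (θ (h * y)).det :=
    (Matrix.isUnit_iff_isUnit_det _).1 ((Group.isUnit (h * y)).map θ)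
  rcases hk _ hu with H | H
  · left
    rw [← map_mul, inv_mul_cancel_left] at H
    exact (halfTreeInd_congr H).symm
  · right
    rw [← map_mul] at H
    exact halfTreeInd_congr H

theorem inHalfTree_lower_iff {κ : ℤ} {a x : R} :
    InHalfTree v κ !![a, 0; x, 1] ↔ (κ : WithTop ℤ) ≤ v a ∧ (κ : WithTop ℤ) ≤ v x := by
  simp [InHalfTree, colVal]

theorem halfTreeInd_lower_eq_zero_left {κ : ℤ} {a x : R} (h : v a < κ) :
    halfTreeInd v κ !![a, 0; x, 1] = 0 := by
  rw [halfTreeInd, if_neg]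
  rw [inHalfTree_lower_iff]
  exact fun H => absurd H.1 (not_le.2 h)

theorem halfTreeInd_lower_eq_zero_right {κ : ℤ} {a x : R} (h : v x < κ) :
    halfTreeInd v κ !![a, 0; x, 1] = 0 := by
  rw [halfTreeInd, if_neg]
  rw [inHalfTree_lower_iff]
  exact fun H => absurd H.2 (not_le.2 h)

theorem halfTreeInd_lower_eq_one {κ : ℤ} {a x : R} (h : (κ : WithTop ℤ) ≤ v a)
    (h' : (κ : WithTop ℤ) ≤ v x) : halfTreeInd v κ !![a, 0; x, 1] = 1 := by
  rw [halfTreeInd, if_pos (inHalfTree_lower_iff.2 ⟨h, h'⟩)]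

/-- A group mapping to `GL₂` of a ring with two places, and containing suitable lifts of a
diagonal and of lower unitriangular matrices, is not finitely presented. -/
theorem not_isFinitelyPresented_of_two_places [Nontrivial R]
    (hvv : ∀ f : R, f ≠ 0 → v f + v' f ≤ 0) {t : R} (ht : v t = (1 : ℤ))
    (ht' : v' t = (-1 : ℤ)) {G : Type*} [Group G] (θ : G →* Matrix (Fin 2) (Fin 2) R)
    {d e : G} (hd : θ d = !![t, 0; 0, 1]) (he : θ e = !![1, 0; 1, 1])
    (hf : ∀ n : ℕ, ∃ f : G, θ f = !![1, 0; t ^ n, 1] ∧ d ^ n * f = e * d ^ n ∧ f * e = e * f) :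
    ¬ IsFinitelyPresented G := by
  intro hG
  obtain ⟨k, ⟨ρ, hρd, hρe⟩, hk⟩ := ((hG.eventually_exists_hom _
    (eventually_windingPerm_mul hvv θ 1) d e).and (Filter.eventually_ge_atTop 1)).exists
  obtain ⟨f, hθf, hdf, hfe⟩ := hf (k + 1)
  have vt : ∀ i : ℕ, v (t ^ i) = (i : ℤ) := fun i => by rw [v.map_pow, ht]; norm_cast; simp
  have vt' : ∀ i : ℕ, v' (t ^ i) = (-i : ℤ) := fun i => by rw [v'.map_pow, ht']; norm_cast; simp
  have v1t : v (1 + t ^ (k + 1)) = (0 : ℤ) := by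
    rw [v.map_add_eq_of_lt_left, v.map_one]; · rfl
    rw [v.map_one, vt]; norm_cast; omega
  have v1t' : v' (1 + t ^ (k + 1)) = (-(k + 1) : ℤ) := by
    rw [v'.map_add_eq_of_lt_right, vt']; · norm_cast
    rw [v'.map_one, vt']; norm_cast; omega
  have θd : ∀ i : ℕ, θ (d ^ i) = !![t ^ i, 0; 0, 1] := by
    intro i
    induction i with
    | zero => simp [Matrix.one_fin_two]
    | succ i ih => rw [pow_succ, map_mul, ih, hd]; simp [pow_succ]
  have θed : θ (e * d ^ (k + 1)) = !![t ^ (k + 1), 0; t ^ (k + 1), 1] := by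
    rw [map_mul, θd, he]; simp
  have θdf : ∀ i, θ (d ^ i * f) = !![t ^ i, 0; t ^ (k + 1), 1] := by
    intro i; rw [map_mul, θd, hθf]; simp
  have θef : θ (e * f) = !![1, 0; 1 + t ^ (k + 1), 1] := by
    rw [map_mul, he, hθf]; simp
  have θde : ∀ i, θ (d ^ i * e) = !![t ^ i, 0; 1, 1] := by
    intro i; rw [map_mul, θd, he]; simp
  have θdfe : ∀ i, θ (d ^ i * (f * e)) = !![t ^ i, 0; 1 + t ^ (k + 1), 1] := by
    intro i; rw [hfe, map_mul, θd, θef]; simp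
  set χ : G → ℤ := fun y => halfTreeInd v 1 (θ y) with hχ
  set χ' : G → ℤ := fun y => halfTreeInd v' (-k) (θ y) with hχ'
  set D := windingPerm χ χ' d with hD
  set E := windingPerm χ χ' e with hE
  have χd0 : χ 1 = 0 := by
    have := θd 0
    rw [pow_zero, pow_zero] at this
    simp only [hχ, this]
    apply halfTreeInd_lower_eq_zero_left
    rw [v.map_one]; norm_cast
  have χ'd : ∀ i ≤ k, χ' (d ^ i) = 1 := by
    intro i hi
    simp only [hχ', θd]
    apply halfTreeInd_lower_eq_one
    · rw [vt']; norm_cast; omega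
    · rw [v'.map_zero]; exact le_top
  have χ'dk : χ' (d ^ (k + 1)) = 0 := by
    simp only [hχ', θd]
    apply halfTreeInd_lower_eq_zero_left
    rw [vt']; norm_cast; omega
  have χdk : χ (d ^ k) = 1 := by
    simp only [hχ, θd]
    apply halfTreeInd_lower_eq_one
    · rw [vt]; norm_cast
    · rw [v.map_zero]; exact le_top
  have χ'df : ∀ i, χ' (d ^ i * f) = 0 := by
    intro i
    simp only [hχ', θdf]
    apply halfTreeInd_lower_eq_zero_right
    rw [vt']; norm_cast; omega
  have χ'ef : χ' (e * f) = 0 := by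
    simp only [hχ', θef]
    apply halfTreeInd_lower_eq_zero_right
    rw [v1t']; norm_cast; omega
  have χde : ∀ i, χ (d ^ i * e) = 0 := by
    intro i
    simp only [hχ, θde]
    apply halfTreeInd_lower_eq_zero_right
    rw [v.map_one]; norm_cast
  have χdfe : ∀ i, χ (d ^ i * (f * e)) = 0 := by
    intro i
    simp only [hχ, θdfe]
    apply halfTreeInd_lower_eq_zero_right
    rw [v1t]; norm_cast
  have p1 : (D ^ (k + 1)) (1, 0) = (d ^ (k + 1), -1) := by
    rw [pow_succ', Equiv.Perm.mul_apply, windingPerm_pow_apply, windingPerm_apply, mul_one,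
      ← pow_succ', χ'dk, χ'd k le_rfl, χdk]
    · norm_num
    · intro i hi
      right
      rw [mul_one, mul_one, χ'd _ hi, χ'd _ hi.le]
  have p2 : E (d ^ (k + 1), -1) = (d ^ (k + 1) * f, -1) := by
    rw [windingPerm_apply, ← hdf, χ'df, χ'dk]; simp
  have p3 : (D ^ (k + 1)) (f, -1) = (d ^ (k + 1) * f, -1) :=
    windingPerm_pow_apply (fun i _ => Or.inr (by rw [χ'df, χ'df])) _
  have p4 : E (f, -1) = (e * f, -1) := by
    have := χ'df 0
    rw [pow_zero, one_mul] at this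
    rw [windingPerm_apply, χ'ef, this]; simp
  have q1 : E (1, 0) = (e, 0) := by
    rw [windingPerm_apply, χd0]; simp
  have q2 : (D ^ (k + 1)) (e, 0) = (d ^ (k + 1) * e, 0) :=
    windingPerm_pow_apply (fun i _ => Or.inl (χde i)) _
  have q3 : E (d ^ (k + 1) * e, 0) = (d ^ (k + 1) * (f * e), 0) := by
    rw [windingPerm_apply, χde, ← mul_assoc, ← hdf, mul_assoc]; simp
  have q4 : (D ^ (k + 1)) (f * e, 0) = (d ^ (k + 1) * (f * e), 0) :=
    windingPerm_pow_apply (fun i _ => Or.inl (χdfe i)) _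
  have hρf : D ^ (k + 1) * ρ f = E * D ^ (k + 1) := by
    rw [← hρd, ← hρe, ← map_pow, ← map_mul, ← map_mul, hdf]
  have r1 : ρ f (1, 0) = (f, -1) := by
    apply (D ^ (k + 1)).injective
    rw [← Equiv.Perm.mul_apply, hρf, Equiv.Perm.mul_apply, p1, p2, p3]
  have r2 : ρ f (e, 0) = (f * e, 0) := by
    apply (D ^ (k + 1)).injective
    rw [← Equiv.Perm.mul_apply, hρf, Equiv.Perm.mul_apply, q2, q3, q4]
  have hcomm : ρ f * E = E * ρ f := by
    rw [← hρe, ← map_mul, ← map_mul, hfe]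
  have hfinal := Equiv.congr_fun hcomm (1, 0)
  rw [Equiv.Perm.mul_apply, Equiv.Perm.mul_apply, q1, r1, r2, p4] at hfinal
  simp at hfinal

end TwoPlaces

section Laurent

variable (F : Type*) [Field F]

/-- The embedding of the Laurent polynomials into the Laurent series. -/
noncomputable def laurentToHahn : LaurentPolynomial F →+* HahnSeries ℤ F :=
  AddMonoidAlgebra.liftNCRingHom (HahnSeries.C : F →+* HahnSeries ℤ F)
    { toFun := fun n => HahnSeries.single n.toAdd 1
      map_one' := rfl
      map_mul' := fun a b => by simp }
    fun _ _ => Commute.all _ _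

variable {F}

theorem laurentToHahn_single (n : ℤ) (a : F) :
    laurentToHahn F (AddMonoidAlgebra.single n a) = HahnSeries.single n a := by
  change AddMonoidAlgebra.liftNC _ _ (AddMonoidAlgebra.single n a) = _
  rw [AddMonoidAlgebra.liftNC_single]
  simp [HahnSeries.C_apply]

theorem coeff_laurentToHahn (f : LaurentPolynomial F) (n : ℤ) :
    (laurentToHahn F f).coeff n = f.coeff n := by
  induction f using LaurentPolynomial.induction_on' with
  | add p q hp hq => simp [hp, hq]
  | C_mul_T m a =>
    rw [← LaurentPolynomial.single_eq_C_mul_T, laurentToHahn_single, HahnSeries.coeff_single,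
      AddMonoidAlgebra.coeff_single, Finsupp.single_apply]
    by_cases h : n = m
    · simp [h]
    · simp [h, Ne.symm h]

variable (F) in
/-- The order of vanishing at `0` of a Laurent polynomial. -/
noncomputable def laurentVal : AddValuation (LaurentPolynomial F) (WithTop ℤ) :=
  (HahnSeries.addVal ℤ F).comap (laurentToHahn F)

variable (F) in
/-- The order of vanishing at `∞` of a Laurent polynomial. -/
noncomputable def laurentValInf : AddValuation (LaurentPolynomial F) (WithTop ℤ) :=
  (laurentVal F).comap
    (LaurentPolynomial.invert : LaurentPolynomial F ≃ₐ[F] LaurentPolynomial F).toRingHom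

theorem laurentVal_le {f : LaurentPolynomial F} {n : ℤ} (h : f.coeff n ≠ 0) :
    laurentVal F f ≤ n :=
  HahnSeries.addVal_le_of_coeff_ne_zero (x := laurentToHahn F f)
    (by rwa [coeff_laurentToHahn])

theorem laurentVal_T (n : ℤ) : laurentVal F (LaurentPolynomial.T n) = n := by
  change HahnSeries.addVal ℤ F (laurentToHahn F (AddMonoidAlgebra.single n 1)) = n
  rw [laurentToHahn_single, HahnSeries.addVal_apply, HahnSeries.orderTop_single one_ne_zero]

theorem laurentValInf_apply (f : LaurentPolynomial F) :
    laurentValInf F f = laurentVal F (LaurentPolynomial.invert f) := rfl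

theorem laurentVal_add_laurentValInf_le (f : LaurentPolynomial F) (hf : f ≠ 0) :
    laurentVal F f + laurentValInf F f ≤ 0 := by
  obtain ⟨n, hn⟩ : ∃ n, f.coeff n ≠ 0 := by
    by_contra! h
    exact hf (LaurentPolynomial.ext fun n => by simp [h n])
  have h1 := laurentVal_le hn
  have h2 : laurentValInf F f ≤ ((-n : ℤ) : WithTop ℤ) := by
    rw [laurentValInf_apply]
    exact laurentVal_le (by rwa [LaurentPolynomial.invert_apply, neg_neg])
  refine (add_le_add h1 h2).trans ?_
  rw [← WithTop.coe_add, add_neg_cancel, WithTop.coe_zero]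

end Laurent

section Parabolic

variable {R : Type*} [CommRing R] {b : ℕ}

theorem parabolic_lower_left_eq_zero {I : Set ℕ} (hI : 2 ∉ I)
    {g : Matrix.SpecialLinearGroup (Fin (2 + b)) R} (hg : g ∈ parabolic (2 + b) R I)
    (i : Fin b) (j : Fin 2) : g.1 (Fin.natAdd 2 i) (Fin.castAdd b j) = 0 := by
  have key : Matrix.BlockTriangular g.1 (fun k : Fin (2 + b) => decide (2 ≤ k.val)) := by
    induction hg using Subgroup.closure_induction with
    | mem x hx =>
      rcases hx with (hx | ⟨i, j, h, r, rfl⟩) | ⟨i, j, h, r, hc, rfl⟩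
      · intro k l hkl
        exact hx fun h => by simp [h] at hkl
      · refine Matrix.blockTriangular_transvection ?_ r
        rw [Bool.le_iff_imp]
        simp only [decide_eq_true_eq]
        have : i.val < j.val := h
        omega
      · refine Matrix.blockTriangular_transvection ?_ r
        rw [Bool.le_iff_imp]
        simp only [decide_eq_true_eq]
        intro hj
        by_contra hi
        exact hI (hc 2 (by omega) hj)
    | one => exact Matrix.blockTriangular_one
    | mul x y _ _ hx hy => exact hx.mul hy
    | inv x _ hx =>
      have hinv : x⁻¹.1 * x.1 = 1 := congrArg Subtype.val (inv_mul_cancel x)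
      have hinv' : x.1 * x⁻¹.1 = 1 := congrArg Subtype.val (mul_inv_cancel x)
      let : Invertible x.1 := ⟨x⁻¹.1, hinv, hinv'⟩
      rw [← Matrix.inv_eq_left_inv hinv]
      exact Matrix.blockTriangular_inv_of_blockTriangular hx
  apply key
  have := j.isLt
  simp [Bool.lt_iff]
  omega

/-- The projection of a parabolic subgroup onto its upper left block of size `2`. -/
def parabolicUpperLeft {I : Set ℕ} (hI : 2 ∉ I) :
    parabolic (2 + b) R I →* Matrix (Fin 2) (Fin 2) R where
  toFun g := g.1.1.submatrix (Fin.castAdd b) (Fin.castAdd b)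
  map_one' := by
    ext i j
    simp [Matrix.one_apply]
  map_mul' g h := by
    ext i j
    simp [Matrix.mul_apply, Fin.sum_univ_add, parabolic_lower_left_eq_zero hI h.2]

/-- The diagonal matrix with entry `u` in position `0`, entry `w` in position `2` and entries `1`
elsewhere. -/
def diagElem (hb : 0 < b) (u w : R) (huw : u * w = 1) :
    Matrix.SpecialLinearGroup (Fin (2 + b)) R :=
  ⟨Matrix.diagonal (Fin.append ![u, 1] fun j : Fin b => if j = ⟨0, hb⟩ then w else 1), by
    simp [Matrix.det_diagonal, Fin.prod_univ_add, huw]⟩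

theorem castAdd_one_ne_castAdd_zero : Fin.castAdd b (1 : Fin 2) ≠ Fin.castAdd b (0 : Fin 2) := by
  simp [Fin.ext_iff]

theorem diagElem_mul_elemMat (hb : 0 < b) (u w : R) (huw : u * w = 1) (r : R) :
    diagElem hb u w huw * elemMat _ _ (castAdd_one_ne_castAdd_zero (b := b)) (u * r) =
      elemMat _ _ castAdd_one_ne_castAdd_zero r * diagElem hb u w huw := by
  apply Subtype.ext
  change Matrix.diagonal _ * Matrix.transvection _ _ _ =
    Matrix.transvection _ _ _ * Matrix.diagonal _
  rw [Matrix.transvection, Matrix.transvection, mul_add, add_mul, mul_one, one_mul]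
  congr 1
  ext i j
  rw [Matrix.diagonal_mul, Matrix.mul_diagonal, Matrix.single_apply, Matrix.single_apply]
  split_ifs with h
  · rw [← h.1, ← h.2, Fin.append_left, Fin.append_left]
    simp [mul_comm]
  · simp

theorem diagElem_pow_mul_elemMat (hb : 0 < b) (u w : R) (huw : u * w = 1) (n : ℕ) (r : R) :
    diagElem hb u w huw ^ n * elemMat _ _ (castAdd_one_ne_castAdd_zero (b := b)) (u ^ n * r) =
      elemMat _ _ castAdd_one_ne_castAdd_zero r * diagElem hb u w huw ^ n := by
  induction n with
  | zero => simp
  | succ n ih =>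
    rw [pow_succ, pow_succ', mul_assoc, mul_assoc u, diagElem_mul_elemMat, ← mul_assoc, ih,
      mul_assoc]

theorem elemMat_mul_comm {n : ℕ} {i j : Fin n} (hij : i ≠ j) (r s : R) :
    elemMat i j hij r * elemMat i j hij s = elemMat i j hij s * elemMat i j hij r := by
  apply Subtype.ext
  change Matrix.transvection _ _ _ * Matrix.transvection _ _ _ =
    Matrix.transvection _ _ _ * Matrix.transvection _ _ _
  rw [Matrix.transvection_mul_transvection_same _ _ hij,
    Matrix.transvection_mul_transvection_same _ _ hij, add_comm]

theorem diagElem_mem_parabolic (I : Set ℕ) (hb : 0 < b) (u w : R) (huw : u * w = 1) :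
    diagElem hb u w huw ∈ parabolic (2 + b) R I :=
  Subgroup.subset_closure (Or.inl (Or.inl (Matrix.isDiag_diagonal _)))

theorem elemMat_mem_parabolic {I : Set ℕ} (hI : 1 ∈ I) (r : R) :
    elemMat _ _ (castAdd_one_ne_castAdd_zero (b := b)) r ∈ parabolic (2 + b) R I := by
  refine Subgroup.subset_closure (Or.inr ⟨Fin.castAdd b 0, Fin.castAdd b 1, ?_, r, ?_, rfl⟩)
  · simp [Fin.lt_def]
  · intro k hk hk'
    simp only [Fin.val_castAdd, Fin.val_zero, Fin.val_one] at hk hk'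
    rwa [show k = 1 by omega]

theorem parabolicUpperLeft_diagElem {I : Set ℕ} (hI : 2 ∉ I) (hb : 0 < b) (u w : R)
    (huw : u * w = 1) :
    parabolicUpperLeft hI ⟨diagElem hb u w huw, diagElem_mem_parabolic I hb u w huw⟩ =
      !![u, 0; 0, 1] := by
  ext i j
  change Matrix.diagonal _ (Fin.castAdd b i) (Fin.castAdd b j) = _
  fin_cases i <;> fin_cases j <;> simp [Fin.ext_iff]

theorem parabolicUpperLeft_elemMat {I : Set ℕ} (hI : 2 ∉ I) (hI' : 1 ∈ I) (r : R) :
    parabolicUpperLeft hI ⟨elemMat _ _ (castAdd_one_ne_castAdd_zero (b := b)) r,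
      elemMat_mem_parabolic hI' r⟩ = !![1, 0; r, 1] := by
  ext i j
  change Matrix.transvection _ _ r (Fin.castAdd b i) (Fin.castAdd b j) = _
  fin_cases i <;> fin_cases j <;> simp [Matrix.transvection, Fin.ext_iff]

end Parabolic

/-- Over the Laurent polynomials F[t,t⁻¹] with F a finite field, the standard maximal
parabolic of SL_{2+b} with Levi blocks of sizes 2 and b ≥ 2 is not finitely presented. -/
theorem maximalParabolic_laurent_not_finitelyPresented
    (F : Type*) [Field F] [Finite F] (b : ℕ) (hb : 2 ≤ b) :
    ¬ IsFinitelyPresented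
      ↥(parabolic (2 + b) (LaurentPolynomial F) (Set.Icc 1 (2 + b - 1) \ {2})) := by
  have hI : (2 : ℕ) ∉ Set.Icc 1 (2 + b - 1) \ {2} := fun h => h.2 rfl
  have hI' : (1 : ℕ) ∈ Set.Icc 1 (2 + b - 1) \ {2} := ⟨⟨le_rfl, by omega⟩, by simp⟩
  have hT : (LaurentPolynomial.T 1 : LaurentPolynomial F) * LaurentPolynomial.T (-1) = 1 := by
    rw [← LaurentPolynomial.T_add]; simp
  have hb0 : 0 < b := by omega
  refine not_isFinitelyPresented_of_two_places laurentVal_add_laurentValInf_le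
    (laurentVal_T 1) (by rw [laurentValInf_apply, LaurentPolynomial.invert_T, laurentVal_T])
    (parabolicUpperLeft hI) (parabolicUpperLeft_diagElem hI hb0 _ _ hT)
    (parabolicUpperLeft_elemMat hI hI' 1) fun n =>
      ⟨_, parabolicUpperLeft_elemMat hI hI' _, ?_, ?_⟩
  · apply Subtype.ext
    have := diagElem_pow_mul_elemMat hb0 _ _ hT n 1
    rw [mul_one] at this
    exact this
  · exact Subtype.ext (elemMat_mul_comm castAdd_one_ne_castAdd_zero _ _)
end
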